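/- arXiv:math/0409223 — 3 statements merged into one kernel-verified Lean document; each statement's English description precedes it below -/
import Mathlib

section
/- Let \mathcal{S} = \{2,4,6,8,10,14\}. Write B_n = \Lambda_n / V_n in lowest terms with V_n > 0. Let k, n be even positive integers with k \in \mathcal{S} and n - k \ge 2. Then D := \gcd(\Lambda_n, V_{n-k}) divides n; moreover D is squarefree, and every prime p dividing D satisfies p \nmid V_k and p \nmid B_n/n. -/
/-- the ring of `p`-integral rationals -/
def SS (p : ℕ) [Fact p.Prime] : Subring ℚ := (Rat.padicValuation p).integer

lemma mem_SS {p : ℕ} [Fact p.Prime] {x : ℚ} : x ∈ SS p ↔ ¬ p ∣ x.den :=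
  Rat.padicValuation_le_one_iff

lemma inv_mem_SS {p : ℕ} [Fact p.Prime] {m : ℤ} (h : ¬ (p : ℤ) ∣ m) : (1 / m : ℚ) ∈ SS p := by
  rw [mem_SS]
  intro hd
  apply h
  have h1 := Rat.den_dvd 1 m
  rw [Rat.divInt_eq_div] at h1
  push_cast at h1
  exact (Int.natCast_dvd_natCast.mpr hd).trans h1

lemma inv_p_not_mem {p : ℕ} [hp : Fact p.Prime] : (1 / p : ℚ) ∉ SS p := by
  rw [mem_SS]
  simp [hp.out.ne_zero]

lemma pow_div_mem {p M N : ℕ} [hp : Fact p.Prime] (hM : M ≠ 0) (hv : M.factorization p ≤ N) :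
    ((p : ℚ) ^ N / M) ∈ SS p := by
  have h1 : p ^ (M.factorization p) * (M / p ^ (M.factorization p)) = M :=
    Nat.ordProj_mul_ordCompl_eq_self M p
  have h2 : ¬ p ∣ M / p ^ (M.factorization p) := Nat.not_dvd_ordCompl hp.out hM
  generalize M.factorization p = e at *
  generalize M / p ^ e = M' at *
  subst h1
  obtain ⟨c, rfl⟩ := Nat.exists_eq_add_of_le hv
  have hp0 : (p : ℚ) ≠ 0 := by exact_mod_cast hp.out.ne_zero
  have hM' : (M' : ℚ) ≠ 0 := by
    rintro h
    have : M' = 0 := by exact_mod_cast h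
    simp [this] at h2
  have : ((p : ℚ) ^ (e + c) / ((p ^ e * M' : ℕ) : ℚ)) = (p : ℚ) ^ c * (1 / (M' : ℤ)) := by
    push_cast
    field_simp
    ring
  rw [this]
  exact mul_mem (pow_mem (natCast_mem _ _) _) (inv_mem_SS (by exact_mod_cast h2))

lemma fact1 {p m : ℕ} (hp5 : 5 ≤ p) : (m + 2).factorization p ≤ m := by
  rcases Nat.eq_zero_or_pos m with rfl | hm
  · rw [Nat.factorization_eq_zero_of_lt (by omega)]
  apply Nat.factorization_le_of_le_pow
  calc m + 2 ≤ 5 ^ m := by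
        induction hm with
        | refl => norm_num
        | step _ ih => rw [pow_succ]; omega
    _ ≤ p ^ m := Nat.pow_le_pow_left hp5 m

lemma fact1' {p m : ℕ} (hp5 : 5 ≤ p) : (m + 3).factorization p ≤ m := by
  rcases Nat.eq_zero_or_pos m with rfl | hm
  · rw [Nat.factorization_eq_zero_of_lt (by omega)]
  apply Nat.factorization_le_of_le_pow
  calc m + 3 ≤ 5 ^ m := by
        induction hm with
        | refl => norm_num
        | step _ ih => rw [pow_succ]; omega
    _ ≤ p ^ m := Nat.pow_le_pow_left hp5 m

lemma fact2 {p m : ℕ} (hp5 : 5 ≤ p) : ((m + 2) * (m + 3)).factorization p ≤ m := by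
  rw [Nat.factorization_mul (by omega) (by omega), Finsupp.add_apply]
  by_cases h : p ∣ m + 2
  · have : ¬ p ∣ m + 3 := by
      intro h'
      have := (Nat.dvd_add_right h).mp (show p ∣ (m + 2) + 1 from h')
      have := Nat.le_of_dvd (by norm_num) this
      omega
    rw [Nat.factorization_eq_zero_of_not_dvd this]
    simpa using fact1 hp5
  · rw [Nat.factorization_eq_zero_of_not_dvd h]
    simpa using fact1' hp5

lemma lemmaA {p : ℕ} [hp : Fact p.Prime] (hp5 : 5 ≤ p) (k : ℕ) (x q : ℤ) :
    ∃ y ∈ SS p, ((x : ℚ) - p * q) ^ (k + 1) =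
      x ^ (k + 1) - (k + 1) * p * q * x ^ k + (k + 1) * p ^ 2 * y := by
  refine ⟨∑ m ∈ Finset.range k, (-q : ℚ) ^ (m + 2) * x ^ (k + 1 - (m + 2)) * (k.choose (m + 1)) *
    ((p : ℚ) ^ m / ((m + 2 : ℕ) : ℚ)), ?_, ?_⟩
  · refine sum_mem fun m _ => mul_mem (mul_mem (mul_mem (pow_mem (neg_mem (intCast_mem _ _)) _)
      (pow_mem (intCast_mem _ _) _)) (natCast_mem _ _)) (pow_div_mem (by omega) (fact1 hp5))
  · rw [show (x : ℚ) - p * q = (-(p * q)) + x by ring, add_pow, Finset.sum_range_succ',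
      Finset.sum_range_succ', Finset.mul_sum]
    have : ∀ m ∈ Finset.range k, (-((p : ℚ) * q)) ^ (m + 1 + 1) * x ^ (k + 1 - (m + 1 + 1)) *
        ((k + 1).choose (m + 1 + 1)) = (k + 1) * p ^ 2 * ((-q : ℚ) ^ (m + 2) *
        x ^ (k + 1 - (m + 2)) * (k.choose (m + 1)) * ((p : ℚ) ^ m / ((m + 2 : ℕ) : ℚ))) := by
      intro m _
      have h : ((k : ℚ) + 1) * (k.choose (m + 1)) = (k + 1).choose (m + 1 + 1) * (m + 1 + 1) := by
        exact_mod_cast Nat.add_one_mul_choose_eq k (m + 1)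
      have h2 : ((m + 2 : ℕ) : ℚ) ≠ 0 := by positivity
      rw [show (-((p : ℚ) * q)) = p * (-q) by ring, mul_pow]
      rw [show m + 1 + 1 = m + 2 by rfl] at *
      generalize (x : ℚ) ^ (k + 1 - (m + 2)) = X at *
      field_simp
      push_cast
      linear_combination (-((p : ℚ) ^ (m + 2) * (-(q : ℚ)) ^ (m + 2) * X)) * h
    rw [Finset.sum_congr rfl this]
    simp
    ring

lemma vs_mem {p : ℕ} [hp : Fact p.Prime] (k : ℕ) (hk : 0 < k) :
    bernoulli (2 * k) + (if (p - 1) ∣ 2 * k then 1 / p else 0 : ℚ) ∈ SS p := by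
  obtain ⟨T, hT⟩ := Bernoulli.vonStaudt_clausen k
  set s := (Finset.range (2 * k + 2)).filter (fun q => q.Prime ∧ (q - 1) ∣ 2 * k) with hs
  have hrest : (∑ q ∈ s.erase p, (1 : ℚ) / q) ∈ SS p := by
    refine sum_mem fun q hq => ?_
    simp only [hs, Finset.mem_erase, Finset.mem_filter] at hq
    have := inv_mem_SS (p := p) (m := (q : ℤ)) (by
      intro h
      exact hq.1 ((Nat.prime_dvd_prime_iff_eq hp.out hq.2.2.1).mp (by exact_mod_cast h)).symm)
    simpa using this
  have key : (∑ q ∈ s, (1 : ℚ) / q) =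
      (if (p - 1) ∣ 2 * k then 1 / p else 0 : ℚ) + ∑ q ∈ s.erase p, (1 : ℚ) / q := by
    split_ifs with h
    · rw [Finset.add_sum_erase s (fun q : ℕ => (1 : ℚ) / q)]
      simp only [hs, Finset.mem_filter, Finset.mem_range]
      have := Nat.le_of_dvd (by omega) h
      exact ⟨by omega, hp.out, h⟩
    · rw [Finset.erase_eq_of_notMem, zero_add]
      simp [hs, h]
  rw [key] at hT
  have : bernoulli (2 * k) + (if (p - 1) ∣ 2 * k then 1 / p else 0 : ℚ) =
      T - ∑ q ∈ s.erase p, (1 : ℚ) / q := by linarith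
  rw [this]
  exact sub_mem (intCast_mem _ _) hrest

lemma odd_mem {p : ℕ} [hp : Fact p.Prime] (hp5 : 5 ≤ p) {i : ℕ} (hi : Odd i) :
    bernoulli i ∈ SS p := by
  rcases eq_or_ne i 1 with rfl | h
  · rw [bernoulli_one]
    have := inv_mem_SS (p := p) (m := 2) (by
      intro h
      have := Int.le_of_dvd (by norm_num) h
      omega)
    have := neg_mem this
    convert this using 1
    norm_num
  · rw [bernoulli_eq_zero_of_odd hi (by have := hi.pos; omega)]
    exact zero_mem _

lemma p_mul_mem {p : ℕ} [hp : Fact p.Prime] (i : ℕ) (hi : Even i) :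
    p * bernoulli i ∈ SS p := by
  rcases Nat.eq_zero_or_pos i with rfl | h0
  · simp
  obtain ⟨k, rfl⟩ := hi
  rw [← two_mul] at *
  have hp0 : (p : ℚ) ≠ 0 := by exact_mod_cast hp.out.ne_zero
  have h := mul_mem (natCast_mem (SS p) p) (vs_mem (p := p) k (by omega))
  split_ifs at h
  · have := sub_mem h (one_mem _)
    convert this using 1
    field_simp
    ring
  · simpa using h

lemma dvd_den_iff {p : ℕ} [hp : Fact p.Prime] (i : ℕ) (hi : Even i) (h0 : 0 < i) :
    p ∣ (bernoulli i).den ↔ (p - 1) ∣ i := by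
  obtain ⟨k, rfl⟩ := hi
  rw [← two_mul] at *
  have h := vs_mem (p := p) k (by omega)
  rw [← not_iff_not, ← mem_SS]
  split_ifs at h with hd
  · refine ⟨fun h' => ?_, fun h' => absurd hd h'⟩
    have := sub_mem h h'
    rw [add_sub_cancel_left] at this
    exact absurd this inv_p_not_mem
  · simpa [hd] using h

lemma den_sqf (i : ℕ) (hi : Even i) : Squarefree (bernoulli i).den := by
  rw [Nat.squarefree_iff_prime_squarefree]
  intro p hp hd
  have : Fact p.Prime := ⟨hp⟩
  have hp0 : (p : ℚ) ≠ 0 := by exact_mod_cast hp.ne_zero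
  have h := p_mul_mem (p := p) i hi
  rw [mem_SS] at h
  apply h
  set x := (p : ℚ) * bernoulli i with hx
  have h1 := Rat.den_dvd x.num (p * x.den : ℤ)
  have h2 : Rat.divInt x.num (p * x.den : ℤ) = bernoulli i := by
    rw [Rat.divInt_eq_div]
    push_cast
    rw [mul_comm, ← div_div, Rat.num_div_den, hx]
    field_simp
  rw [h2] at h1
  have h3 : (bernoulli i).den ∣ p * x.den := by exact_mod_cast h1
  exact Nat.dvd_of_mul_dvd_mul_left hp.pos (hd.trans h3)

lemma lemmaB {p : ℕ} [hp : Fact p.Prime] (hp5 : 5 ≤ p) (n : ℕ) (hn : Even n) (h0 : 0 < n) :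
    ∃ y ∈ SS p, (∑ j ∈ Finset.range p, (j : ℚ) ^ n) = p * bernoulli n + n * p ^ 2 * y := by
  have hp0 : (p : ℚ) ≠ 0 := by exact_mod_cast hp.out.ne_zero
  have hn0 : (n : ℚ) ≠ 0 := by exact_mod_cast h0.ne'
  rw [sum_range_pow, Finset.sum_range_succ]
  refine ⟨∑ i ∈ Finset.range n, (bernoulli i * ((n + 1).choose i) * (p : ℚ) ^ (n + 1 - i) /
    (n + 1)) / (n * p ^ 2), ?_, ?_⟩
  · refine sum_mem fun i hi => ?_
    rw [Finset.mem_range] at hi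
    obtain ⟨d, rfl⟩ : ∃ d, n = i + d + 1 := ⟨n - i - 1, by omega⟩
    have e1 : i + d + 1 + 1 - i = d + 2 := by omega
    have c1 : ((i + d + 1).choose i : ℚ) * (i + d + 1 + 1) = ((i + d + 1 + 1).choose i) * (d + 2) := by
      have := Nat.choose_mul_succ_eq (i + d + 1) i
      rw [e1] at this
      exact_mod_cast this
    have c2 : ((i + d).choose i : ℚ) * (i + d + 1) = ((i + d + 1).choose i) * (d + 1) := by
      have := Nat.choose_mul_succ_eq (i + d) i
      rw [show i + d + 1 - i = d + 1 by omega] at this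
      exact_mod_cast this
    have hd1 : ((d : ℚ) + 1) ≠ 0 := by positivity
    have hd2 : ((d : ℚ) + 2) ≠ 0 := by positivity
    have hid : ((i : ℚ) + d + 1) ≠ 0 := by positivity
    have hid2 : ((i : ℚ) + d + 1 + 1) ≠ 0 := by positivity
    have key : (bernoulli i * ((i + d + 1 + 1).choose i) * (p : ℚ) ^ (i + d + 1 + 1 - i) /
        ((i + d + 1 : ℕ) + 1)) / ((i + d + 1 : ℕ) * p ^ 2) =
        bernoulli i * ((i + d).choose i) * ((p : ℚ) ^ d / ((d + 1) * (d + 2))) := by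
      have c3 : ((i + d + 1 + 1).choose i : ℚ) =
          ((i + d).choose i : ℚ) * (i + d + 1) / (d + 1) * (i + d + 1 + 1) / (d + 2) := by
        rw [c2]; field_simp; linarith
      rw [c3, e1]
      push_cast
      field_simp
      ring
    rw [key]
    rcases Nat.eq_zero_or_pos d with rfl | hd
    · refine mul_mem (mul_mem (odd_mem hp5 ?_) (natCast_mem _ _)) ?_
      · rw [add_zero] at hn
        exact Nat.not_even_iff_odd.mp fun h => by
          have := h.add_one; exact (Nat.not_even_iff_odd.mpr this) hn
      · have := inv_mem_SS (p := p) (m := 2) (by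
          intro h
          have := Int.le_of_dvd (by norm_num) h
          omega)
        simpa using this
    · obtain ⟨e, rfl⟩ : ∃ e, d = e + 1 := ⟨d - 1, by omega⟩
      have hm : (p : ℚ) * bernoulli i ∈ SS p := by
        rcases Nat.even_or_odd i with h | h
        · exact p_mul_mem i h
        · exact mul_mem (natCast_mem _ _) (odd_mem hp5 h)
      have := mul_mem (mul_mem hm (natCast_mem (SS p) ((i + (e + 1)).choose i)))
        (pow_div_mem (p := p) (M := (e + 2) * (e + 3)) (N := e) (by positivity) (fact2 hp5))
      convert this using 1
      push_cast
      rw [show ((e : ℚ) + 1 + 1) = e + 2 by ring, show ((e : ℚ) + 1 + 2) = e + 3 by ring]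
      ring
  · rw [← Finset.sum_div _ _ ((n : ℚ) * p ^ 2), add_tsub_cancel_left, Nat.choose_succ_self_right]
    generalize (∑ i ∈ Finset.range n, (bernoulli i * ((n + 1).choose i) * (p : ℚ) ^ (n + 1 - i) /
      (n + 1))) = Q
    have hn1 : (n : ℚ) + 1 ≠ 0 := by positivity
    push_cast
    field_simp
    ring

lemma perm_sum {p : ℕ} [hp : Fact p.Prime] {a : ℕ} (ha : ¬ p ∣ a) (n : ℕ) :
    ∑ j ∈ Finset.range p, ((j * a % p : ℕ) : ℚ) ^ n = ∑ j ∈ Finset.range p, (j : ℚ) ^ n := by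
  have hinj : Set.InjOn (fun j => j * a % p) (Finset.range p : Set ℕ) := by
    intro x hx y hy h
    simp only [Finset.coe_range, Set.mem_Iio] at hx hy
    have h' : x * a ≡ y * a [MOD p] := h
    have := Nat.ModEq.cancel_right_of_coprime
      ((Nat.Prime.coprime_iff_not_dvd hp.out).mpr ha) h'
    exact Nat.ModEq.eq_of_lt_of_lt this hx hy
  have himg : (Finset.range p).image (fun j => j * a % p) = Finset.range p := by
    apply Finset.eq_of_subset_of_card_le
    · intro x hx
      simp only [Finset.mem_image, Finset.mem_range] at hx ⊢
      obtain ⟨j, _, rfl⟩ := hx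
      exact Nat.mod_lt _ hp.out.pos
    · rw [Finset.card_image_of_injOn hinj]
  conv_rhs => rw [← himg]
  rw [Finset.sum_image hinj]

lemma voronoi {p : ℕ} [hp : Fact p.Prime] (hp5 : 5 ≤ p) {a : ℕ} (ha : ¬ p ∣ a) (n : ℕ)
    (hn : Even n) (h0 : 0 < n) :
    ∃ y ∈ SS p, ((a : ℚ) ^ n - 1) * (bernoulli n / n) =
      ((∑ j ∈ Finset.range p, ((j * a / p : ℕ) : ℤ) * ((j * a : ℕ) : ℤ) ^ (n - 1) : ℤ) : ℚ)
        + p * y := by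
  have hp0 : (p : ℚ) ≠ 0 := by exact_mod_cast hp.out.ne_zero
  have hn0 : (n : ℚ) ≠ 0 := by exact_mod_cast h0.ne'
  obtain ⟨y, hy, hB⟩ := lemmaB hp5 n hn h0
  obtain ⟨k, rfl⟩ : ∃ k, n = k + 1 := ⟨n - 1, by omega⟩
  choose z hz hA using fun j : ℕ => lemmaA hp5 k ((j * a : ℕ) : ℤ) ((j * a / p : ℕ) : ℤ)
  have hperm := perm_sum ha (k + 1)
  have hterm : ∀ j ∈ Finset.range p, ((j * a % p : ℕ) : ℚ) ^ (k + 1) =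
      (a : ℚ) ^ (k + 1) * (j : ℚ) ^ (k + 1) - (k + 1) * p *
        (((j * a / p : ℕ) : ℚ) * ((j * a : ℕ) : ℚ) ^ k) + (k + 1) * p ^ 2 * z j := by
    intro j _
    have h := hA j
    have h1 : ((j * a % p : ℕ) : ℚ) = (((j * a : ℕ) : ℤ) : ℚ) - p * (((j * a / p : ℕ) : ℤ) : ℚ) := by
      have : ((p * (j * a / p) + j * a % p : ℕ) : ℚ) = ((j * a : ℕ) : ℚ) := by
        rw [Nat.div_add_mod]
      rw [Nat.cast_add, Nat.cast_mul] at this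
      rw [Int.cast_natCast, Int.cast_natCast]
      linarith
    rw [h1, h, Int.cast_natCast, Int.cast_natCast, Nat.cast_mul, mul_pow]
    ring
  rw [Finset.sum_congr rfl hterm, Finset.sum_add_distrib, Finset.sum_sub_distrib,
    ← Finset.mul_sum, ← Finset.mul_sum, ← Finset.mul_sum, hB] at hperm
  refine ⟨-(((a : ℚ) ^ (k + 1) - 1) * y) - ∑ j ∈ Finset.range p, z j, ?_, ?_⟩
  · exact sub_mem (neg_mem (mul_mem (sub_mem (pow_mem (natCast_mem _ _) _) (one_mem _)) hy))
      (sum_mem fun j _ => hz j)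
  · rw [Int.cast_sum]
    have e : ∀ j ∈ Finset.range p,
        (((((j * a / p : ℕ) : ℤ) * ((j * a : ℕ) : ℤ) ^ (k + 1 - 1) : ℤ)) : ℚ) =
        (((j * a / p : ℕ) : ℚ) * ((j * a : ℕ) : ℚ) ^ k) := by
      intro j _
      rw [Int.cast_mul, Int.cast_pow, Int.cast_natCast, Int.cast_natCast, add_tsub_cancel_right]
    rw [Finset.sum_congr rfl e]
    generalize (∑ j ∈ Finset.range p, ((j * a / p : ℕ) : ℚ) * ((j * a : ℕ) : ℚ) ^ k) = Q at *
    generalize (∑ j ∈ Finset.range p, z j) = Z at *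
    have hpn : (p : ℚ) * (k + 1) ≠ 0 := by positivity
    push_cast at *
    have : (p : ℚ) * (k + 1) * (((a : ℚ) ^ (k + 1) - 1) * (bernoulli (k + 1) / (k + 1))) =
      p * (k + 1) * (Q + p * (-(((a : ℚ) ^ (k + 1) - 1) * y) - Z)) := by
      have hb : bernoulli (k + 1) / (k + 1 : ℚ) * (k + 1) = bernoulli (k + 1) :=
        div_mul_cancel₀ _ hn0
      linear_combination hperm + p * ((a : ℚ) ^ (k + 1) - 1) * hb
    exact mul_left_cancel₀ hpn this


lemma sum_congr_mod {p : ℕ} [hp : Fact p.Prime] {a n k t : ℕ} (hk : 2 ≤ k)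
    (hn : n = k + (p - 1) * t) :
    ((p : ℤ) ∣ (∑ j ∈ Finset.range p, ((j * a / p : ℕ) : ℤ) * ((j * a : ℕ) : ℤ) ^ (n - 1)) -
      ∑ j ∈ Finset.range p, ((j * a / p : ℕ) : ℤ) * ((j * a : ℕ) : ℤ) ^ (k - 1)) := by
  rw [← Finset.sum_sub_distrib]
  refine Finset.dvd_sum fun j _ => ?_
  rw [← mul_sub]
  apply Dvd.dvd.mul_left
  rw [← ZMod.intCast_zmod_eq_zero_iff_dvd]
  generalize j * a = x
  rw [show n - 1 = (k - 1) + (p - 1) * t by omega]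
  push_cast
  rw [pow_add, pow_mul]
  by_cases hx : (x : ZMod p) = 0
  · rw [hx, zero_pow (show k - 1 ≠ 0 by omega)]
    simp
  · rw [ZMod.pow_card_sub_one_eq_one hx]
    simp

lemma exists_a (p : ℕ) [hp : Fact p.Prime] : ∃ a : ℕ, ¬ p ∣ a ∧
    (∀ n, ¬ (p - 1) ∣ n → ¬ (p : ℤ) ∣ (a : ℤ) ^ n - 1) := by
  obtain ⟨g, hg⟩ := IsCyclic.exists_generator (α := (ZMod p)ˣ)
  have ho := orderOf_eq_card_of_forall_mem_zpowers hg
  rw [Nat.card_eq_fintype_card, ZMod.card_units] at ho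
  refine ⟨(g : ZMod p).val, ?_, ?_⟩
  · rw [← ZMod.natCast_eq_zero_iff, ZMod.natCast_zmod_val]
    exact g.ne_zero
  · intro n hn hd
    apply hn
    rw [← ho, orderOf_dvd_iff_pow_eq_one]
    rw [← ZMod.intCast_zmod_eq_zero_iff_dvd] at hd
    push_cast at hd
    rw [ZMod.natCast_zmod_val, sub_eq_zero] at hd
    ext
    simpa using hd

/-- Kummer's congruence mod `p`. -/
lemma kummer {p : ℕ} [hp : Fact p.Prime] (hp5 : 5 ≤ p) {n k : ℕ} (hne : Even n) (hke : Even k)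
    (hk : 2 ≤ k) (hkn : k ≤ n) (hd : (p - 1) ∣ n - k) (hndvd : ¬ (p - 1) ∣ n) :
    ∃ y ∈ SS p, bernoulli n / n = bernoulli k / k + p * y := by
  obtain ⟨t, ht⟩ := hd
  have hn : n = k + (p - 1) * t := by omega
  have hkd : ¬ (p - 1) ∣ k := fun h => hndvd (by rw [hn]; exact h.add (Dvd.intro _ rfl))
  obtain ⟨a, ha, hord⟩ := exists_a p
  obtain ⟨y, hy, h1⟩ := voronoi hp5 ha n hne (by omega)
  obtain ⟨z, hz, h2⟩ := voronoi hp5 ha k hke (by omega)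
  obtain ⟨c, hc⟩ := sum_congr_mod (a := a) hk hn
  have hc' := congrArg (Int.cast : ℤ → ℚ) hc
  rw [Int.cast_sub, Int.cast_mul, Int.cast_natCast] at hc'
  have hpow : (p : ℤ) ∣ (a : ℤ) ^ n - (a : ℤ) ^ k := by
    rw [← ZMod.intCast_zmod_eq_zero_iff_dvd]
    push_cast
    rw [hn, pow_add, pow_mul, ZMod.pow_card_sub_one_eq_one]
    · simp
    · rwa [Ne, ZMod.natCast_eq_zero_iff]
  obtain ⟨e, he⟩ := hpow
  have he' : (a : ℚ) ^ n - (a : ℚ) ^ k = p * e := by exact_mod_cast he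
  have un := inv_mem_SS (hord n hndvd)
  have uk := inv_mem_SS (hord k hkd)
  have un0 : (a : ℚ) ^ n - 1 ≠ 0 := by
    intro h
    have : (a : ℤ) ^ n - 1 = 0 := by exact_mod_cast h
    exact hord n hndvd (by rw [this]; exact dvd_zero _)
  have uk0 : (a : ℚ) ^ k - 1 ≠ 0 := by
    intro h
    have : (a : ℤ) ^ k - 1 = 0 := by exact_mod_cast h
    exact hord k hkd (by rw [this]; exact dvd_zero _)
  push_cast at un uk
  have hbk : bernoulli k / k ∈ SS p := by
    have : bernoulli k / k = 1 / ((a : ℚ) ^ k - 1) * (((a : ℚ) ^ k - 1) * (bernoulli k / k)) := by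
      rw [← mul_assoc, one_div_mul_cancel uk0, one_mul]
    rw [this, h2]
    exact mul_mem uk (add_mem (intCast_mem _ _) (mul_mem (natCast_mem _ _) hz))
  refine ⟨1 / ((a : ℚ) ^ n - 1) * (c + y - z - e * (bernoulli k / k)), ?_, ?_⟩
  · exact mul_mem un (sub_mem (sub_mem (add_mem (intCast_mem _ _) hy) hz)
      (mul_mem (intCast_mem _ _) hbk))
  · apply mul_left_cancel₀ un0
    rw [mul_add, show ((a : ℚ) ^ n - 1) * (p * (1 / ((a : ℚ) ^ n - 1) *
      (c + y - z - e * (bernoulli k / k)))) = p * (c + y - z - e * (bernoulli k / k)) by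
        field_simp]
    linear_combination h1 - h2 + hc' - (bernoulli k / k) * he'

lemma bern_vals {k : ℕ} (hk : k ∈ ({2, 4, 6, 8, 10, 14} : Finset ℕ)) :
    ∃ m : ℤ, (bernoulli k / k) * m = 1 := by
  have h3 := sum_bernoulli 3
  have h5 := sum_bernoulli 5
  have h7 := sum_bernoulli 7
  have h9 := sum_bernoulli 9
  have h11 := sum_bernoulli 11
  have h13 := sum_bernoulli 13
  have h15 := sum_bernoulli 15
  have o3 : bernoulli 3 = 0 := bernoulli_eq_zero_of_odd (by decide) (by norm_num)
  have o5 : bernoulli 5 = 0 := bernoulli_eq_zero_of_odd (by decide) (by norm_num)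
  have o7 : bernoulli 7 = 0 := bernoulli_eq_zero_of_odd (by decide) (by norm_num)
  have o9 : bernoulli 9 = 0 := bernoulli_eq_zero_of_odd (by decide) (by norm_num)
  have o11 : bernoulli 11 = 0 := bernoulli_eq_zero_of_odd (by decide) (by norm_num)
  have o13 : bernoulli 13 = 0 := bernoulli_eq_zero_of_odd (by decide) (by norm_num)
  norm_num [Finset.sum_range_succ, Nat.choose, o3, o5, o7, o9, o11, o13]
    at h5 h7 h9 h11 h13 h15
  have b4 : bernoulli 4 = -1 / 30 := by linarith
  rw [b4] at h7 h9 h11 h13 h15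
  have b6 : bernoulli 6 = 1 / 42 := by linarith
  rw [b6] at h9 h11 h13 h15
  have b8 : bernoulli 8 = -1 / 30 := by linarith
  rw [b8] at h11 h13 h15
  have b10 : bernoulli 10 = 5 / 66 := by linarith
  rw [b10] at h13 h15
  have b12 : bernoulli 12 = -691 / 2730 := by linarith
  rw [b12] at h15
  have b14 : bernoulli 14 = 7 / 6 := by linarith
  simp only [Finset.mem_insert, Finset.mem_singleton] at hk
  rcases hk with rfl | rfl | rfl | rfl | rfl | rfl
  · exact ⟨12, by norm_num⟩
  · exact ⟨-120, by norm_num [b4]⟩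
  · exact ⟨252, by norm_num [b6]⟩
  · exact ⟨-240, by norm_num [b8]⟩
  · exact ⟨132, by norm_num [b10]⟩
  · exact ⟨12, by norm_num [b14]⟩

lemma num_dvd_mem {p : ℕ} [hp : Fact p.Prime] {x : ℚ} (h : (p : ℤ) ∣ x.num) :
    ∃ y ∈ SS p, x = p * y := by
  obtain ⟨c, hc⟩ := h
  have hd : ¬ (p : ℤ) ∣ (x.den : ℤ) := by
    intro h'
    have h1 : p ∣ x.num.natAbs := by rw [← Int.natCast_dvd, hc]; exact Dvd.intro _ rfl
    have h2 : p ∣ x.den := by exact_mod_cast h'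
    have := Nat.dvd_gcd h1 h2
    rw [x.reduced.gcd_eq_one] at this
    exact hp.out.one_lt.ne' (Nat.dvd_one.mp this)
  refine ⟨c * (1 / ((x.den : ℤ) : ℚ)), mul_mem (intCast_mem _ _) (inv_mem_SS hd), ?_⟩
  conv_lhs => rw [← Rat.num_div_den x, hc]
  push_cast
  ring

lemma main_prime {k n : ℕ} (hk : k ∈ ({2, 4, 6, 8, 10, 14} : Finset ℕ))
    (hne : Even n) (hnk : 2 ≤ n - k) (hkn : k ≤ n) (q : ℕ) (hq : q.Prime)
    (hd : q ∣ Int.gcd (bernoulli n).num ((bernoulli (n - k)).den : ℤ)) :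
    q ∣ n ∧ ¬ q ∣ (bernoulli k).den ∧ ¬ (q : ℤ) ∣ (bernoulli n / n).num := by
  have : Fact q.Prime := ⟨hq⟩
  obtain ⟨m, hm⟩ := bern_vals hk
  have hk2 : Even k ∧ 2 ≤ k := by
    simp only [Finset.mem_insert, Finset.mem_singleton] at hk
    rcases hk with rfl | rfl | rfl | rfl | rfl | rfl <;> decide
  obtain ⟨hke, hk2⟩ := hk2
  have hnke : Even (n - k) := (Nat.even_sub hkn).mpr (by tauto)
  have hd1 : (q : ℤ) ∣ (bernoulli n).num := (Int.natCast_dvd_natCast.mpr hd).trans (Int.gcd_dvd_left _ _)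
  have hd2 : q ∣ (bernoulli (n - k)).den := by
    have := (Int.natCast_dvd_natCast.mpr hd).trans (Int.gcd_dvd_right (bernoulli n).num _)
    exact_mod_cast this
  rw [dvd_den_iff _ hnke (by omega)] at hd2
  obtain ⟨y, hy, hBy⟩ := num_dvd_mem hd1
  have hqn : ¬ (q - 1) ∣ n := by
    rw [← dvd_den_iff _ hne (by omega), ← mem_SS, hBy]
    exact mul_mem (natCast_mem _ _) hy
  have hqk : ¬ (q - 1) ∣ k := by
    intro h
    apply hqn
    rw [← Nat.sub_add_cancel hkn]
    exact hd2.add h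
  have hq5 : 5 ≤ q := by
    by_contra hlt
    have h2 := hq.two_le
    have h2n := hne.two_dvd
    interval_cases q
    · exact hqn (by simp)
    · exact hqn (by simpa using h2n)
    · exact absurd hq (by decide)
  obtain ⟨w, hw, hK⟩ := kummer hq5 hne hke hk2 hkn hd2 hqn
  have hnot : ∀ z ∈ SS q, bernoulli n / n ≠ q * z := by
    intro z hz h
    have hq0 : (q : ℚ) ≠ 0 := by exact_mod_cast hq.ne_zero
    apply inv_p_not_mem (p := q)
    have : (1 / q : ℚ) = (z - w) * m := by
      field_simp
      linear_combination -hm - (m : ℚ) * hK + (m : ℚ) * h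
    rw [this]
    exact mul_mem (sub_mem hz hw) (intCast_mem _ _)
  refine ⟨?_, ?_, ?_⟩
  · by_contra h
    refine hnot (y * (1 / ((n : ℤ) : ℚ))) (mul_mem hy (inv_mem_SS (by exact_mod_cast h))) ?_
    rw [hBy]
    push_cast
    ring
  · rwa [dvd_den_iff _ hke (by omega)]
  · intro h
    obtain ⟨z, hz, h⟩ := num_dvd_mem h
    exact hnot z hz h

/-- Write `B_n = Λ_n / V_n` in lowest terms. For even `k ∈ {2,4,6,8,10,14}` and
even `n` with `n - k ≥ 2`, the gcd `D = (Λ_n, V_{n-k})` divides `n`; moreover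
`D` is squarefree and every prime `q ∣ D` satisfies `q ∤ V_k` and `q ∤ B_n/n`. -/
theorem stmt_13 (k n : ℕ)
    (hk : k ∈ ({2, 4, 6, 8, 10, 14} : Finset ℕ))
    (hne : Even n) (hnk : 2 ≤ n - k) (hkn : k ≤ n) :
    Int.gcd (bernoulli n).num ((bernoulli (n - k)).den : ℤ) ∣ n ∧
    Squarefree (Int.gcd (bernoulli n).num ((bernoulli (n - k)).den : ℤ)) ∧
    ∀ q : ℕ, q.Prime → q ∣ Int.gcd (bernoulli n).num ((bernoulli (n - k)).den : ℤ) →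
      ¬ q ∣ (bernoulli k).den ∧ ¬ (q : ℤ) ∣ (bernoulli n / n).num := by
  have hnke : Even (n - k) := by
    have hke : Even k := by
      simp only [Finset.mem_insert, Finset.mem_singleton] at hk
      rcases hk with rfl | rfl | rfl | rfl | rfl | rfl <;> decide
    exact (Nat.even_sub hkn).mpr (by tauto)
  have hsq : Squarefree (Int.gcd (bernoulli n).num ((bernoulli (n - k)).den : ℤ)) := by
    refine (den_sqf (n - k) hnke).squarefree_of_dvd ?_
    have := Int.gcd_dvd_right (bernoulli n).num ((bernoulli (n - k)).den : ℤ)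
    exact_mod_cast this
  refine ⟨?_, hsq, fun q hq hd => (main_prime hk hne hnk hkn q hq hd).2⟩
  rw [← Nat.prod_primeFactors_of_squarefree hsq]
  refine Finset.prod_primes_dvd _ (fun q hq => ?_) (fun q hq => ?_)
  · exact (Nat.prime_of_mem_primeFactors hq).prime
  · exact (main_prime hk hne hnk hkn q (Nat.prime_of_mem_primeFactors hq)
      (Nat.dvd_of_mem_primeFactors hq)).1
end

section
/- Let (p, l_n) be an irregular pair of order n (p^n divides the numerator of B_{l_n}/l_n, l_n even, 2 \le l_n < (p-1)p^{n-1}) with \Delta_{(p,l_n)} \ne 0, where \Delta_{(p,l_n)} \equiv p^{-n}( B_{l_n+(p-1)p^{n-1}}/(l_n+(p-1)p^{n-1}) - B_{l_n}/l_n ) (mod p). Then there exists exactly one s with 0 \le s < p such that (p, l_n + s(p-1)p^{n-1}) is an irregular pair of order n+1, namely s \equiv -\alpha_0 \Delta_{(p,l_n)}^{-1} (mod p) where \alpha_0 \equiv p^{-n} B_{l_n}/l_n (mod p). -/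
open Finset Filter Topology

lemma aux_dvd_num_iff (p : ℕ) [hp : Fact p.Prime] (x : ℚ) (m : ℕ) (hm : 1 ≤ m) :
    (p : ℤ)^m ∣ x.num ↔ ‖(x : ℚ_[p])‖ ≤ (p : ℝ)^(-m : ℤ) := by
  have hx : (x : ℚ_[p]) = (x.num : ℚ_[p]) / (x.den : ℚ_[p]) := by
    conv_lhs => rw [← Rat.num_div_den x]
    push_cast; rfl
  have hp1 : (1 : ℝ) < p := by exact_mod_cast hp.1.one_lt
  have hlt : (p : ℝ)^(-m : ℤ) < 1 := by
    rw [zpow_neg, zpow_natCast]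
    exact inv_lt_one_of_one_lt₀ (one_lt_pow₀ hp1 (by omega))
  have hcop : ¬ ((p : ℤ) ∣ x.num ∧ p ∣ x.den) := by
    rintro ⟨h1, h2⟩
    have := x.reduced
    exact Nat.not_coprime_of_dvd_of_dvd hp.1.one_lt (Int.natCast_dvd.1 h1) h2 this
  rw [← Padic.norm_int_le_pow_iff_dvd, hx, norm_div]
  have hden : ∀ h : ¬ p ∣ x.den, ‖(x.den : ℚ_[p])‖ = 1 := fun h => by
    rw [Padic.norm_natCast_eq_one_iff]; exact (hp.1.coprime_iff_not_dvd).2 h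
  constructor
  · intro h
    have : (p : ℤ) ∣ x.num := by
      rw [← Padic.norm_intCast_lt_one_iff]; exact h.trans_lt hlt
    rw [hden (fun h2 => hcop ⟨this, h2⟩)]; simpa using h
  · intro h
    by_cases h2 : p ∣ x.den
    · exfalso
      have h3 : ¬ (p : ℤ) ∣ x.num := fun h' => hcop ⟨h', h2⟩
      have h4 : ‖(x.num : ℚ_[p])‖ = 1 := by
        apply le_antisymm (Padic.norm_int_le_one _)
        rw [← not_lt, Padic.norm_intCast_lt_one_iff]; exact h3
      have h5 : ‖(x.den : ℚ_[p])‖ ≤ 1 := by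
        simpa using Padic.norm_int_le_one (p := p) (x.den : ℤ)
      have h6 : 0 < ‖(x.den : ℚ_[p])‖ := by
        rw [norm_pos_iff]; exact_mod_cast x.den_nz
      rw [h4] at h
      have := (one_le_div h6).2 h5
      linarith
    · rw [hden h2] at h; simpa using h

lemma aux_pow_tendsto (p : ℕ) [hp : Fact p.Prime] :
    Tendsto (fun M : ℕ => ((p : ℚ_[p])^M)) atTop (𝓝 0) :=
  tendsto_pow_atTop_nhds_zero_of_norm_lt_one Padic.norm_p_lt_one

lemma aux_sum_tendsto (p : ℕ) [hp : Fact p.Prime] (k : ℕ) :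
    Tendsto (fun M : ℕ => ((∑ j ∈ range (p^M), (j : ℤ)^k : ℤ) : ℚ_[p]) / (p : ℚ_[p])^M) atTop
      (𝓝 (bernoulli k : ℚ_[p])) := by
  have h0 : (p : ℚ_[p]) ≠ 0 := by exact_mod_cast hp.1.ne_zero
  have key : ∀ M : ℕ, ((∑ j ∈ range (p^M), (j : ℤ)^k : ℤ) : ℚ_[p]) / (p : ℚ_[p])^M =
      ∑ i ∈ range (k+1), (bernoulli i : ℚ_[p]) * ((k+1).choose i : ℚ_[p]) / (k+1) *
        ((p : ℚ_[p])^M)^(k - i) := by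
    intro M
    have := sum_range_pow (p^M) k
    have h2 := congrArg (fun x : ℚ => (x : ℚ_[p])) this
    push_cast at h2
    push_cast
    rw [h2, sum_div]
    apply sum_congr rfl
    intro i hi
    have : k + 1 - i = (k - i) + 1 := by have := mem_range.1 hi; omega
    rw [this, pow_succ ((p : ℚ_[p])^M) (k - i)]
    field_simp
  simp_rw [key]
  have : (bernoulli k : ℚ_[p]) = ∑ i ∈ range (k+1), (bernoulli i : ℚ_[p]) * ((k+1).choose i : ℚ_[p]) / (k+1) * (0:ℚ_[p])^(k - i) := by
    rw [sum_range_succ, sum_eq_zero]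
    · have : (k : ℚ_[p]) + 1 ≠ 0 := by exact_mod_cast Nat.succ_ne_zero k
      simp
      field_simp
    · intro i hi
      have := mem_range.1 hi
      rw [zero_pow (by omega), mul_zero]
  rw [this]
  apply tendsto_finsetSum
  intro i hi
  exact ((aux_pow_tendsto p).pow (k - i)).const_mul _

lemma aux_voronoi (m c k : ℕ) (hm : 0 < m) (hc : Nat.Coprime m c) (hk : 1 ≤ k) :
    (m : ℤ)^2 ∣ ((c : ℤ)^k - 1) * ∑ j ∈ range m, (j : ℤ)^k
      - k * m * ∑ j ∈ range m, ((c * j : ℕ) : ℤ)^(k-1) * ((c * j / m : ℕ) : ℤ) := by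
  have hperm : ∑ j ∈ range m, (j : ℤ)^k = ∑ j ∈ range m, ((c * j % m : ℕ) : ℤ)^k := by
    symm
    have hinj : Set.InjOn (fun j => c * j % m) (range m) := by
      intro a ha b hb hab
      have ha := mem_range.1 (mem_coe.1 ha)
      have hb := mem_range.1 (mem_coe.1 hb)
      have : a ≡ b [MOD m] := Nat.ModEq.cancel_left_of_coprime hc hab
      rwa [Nat.ModEq, Nat.mod_eq_of_lt ha, Nat.mod_eq_of_lt hb] at this
    have himg : (range m).image (fun j => c * j % m) = range m := by
      apply eq_of_subset_of_card_le
      · intro x hx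
        obtain ⟨y, _, rfl⟩ := mem_image.1 hx
        exact mem_range.2 (Nat.mod_lt _ hm)
      · rw [card_image_of_injOn hinj]
    conv_rhs => rw [← himg]
    rw [sum_image hinj]
  have : ((c : ℤ)^k - 1) * ∑ j ∈ range m, (j : ℤ)^k
      - k * m * ∑ j ∈ range m, ((c * j : ℕ) : ℤ)^(k-1) * ((c * j / m : ℕ) : ℤ)
      = ∑ j ∈ range m, (((c * j : ℕ) : ℤ)^k - ((c * j % m : ℕ) : ℤ)^k - k * m * (((c * j : ℕ) : ℤ)^(k-1) * ((c * j / m : ℕ) : ℤ))) := by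
    rw [sum_sub_distrib, sum_sub_distrib, ← hperm, sub_mul, ← mul_sum, one_mul, mul_sum _ _ ((c : ℤ)^k)]
    simp only [Nat.cast_mul, mul_pow]
  rw [this]
  apply dvd_sum
  intro j hj
  have h1 : ((c * j % m : ℕ) : ℤ) = ((c * j : ℕ) : ℤ) - m * ((c * j / m : ℕ) : ℤ) := by
    have := Nat.mod_add_div (c*j) m
    rw [eq_sub_iff_add_eq]; exact_mod_cast this
  rw [h1]
  generalize ((c * j : ℕ) : ℤ) = x
  generalize ((c * j / m : ℕ) : ℤ) = q
  obtain ⟨k, rfl⟩ : ∃ t, k = t + 1 := ⟨k-1, by omega⟩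
  have h2 : ∀ t : ℕ, (m : ℤ)^2 ∣ x^(t+1) - (x - m * q)^(t+1) - (t+1) * m * (x^t * q) := by
    intro t
    induction t with
    | zero => simp
    | succ t ih =>
      obtain ⟨y, hy⟩ := ih
      have : (x - m*q)^(t+1) = x^(t+1) - (t+1) * m * (x^t * q) - m^2 * y := by linarith
      refine ⟨(x - m*q) * y - (t+1) * x^t * q^2, ?_⟩
      rw [pow_succ (x - m*q) (t+1), this]
      push_cast
      ring
  simpa using h2 k

/-- The sum `T`. -/
def auxT (p c k M : ℕ) : ℤ :=
  ∑ j ∈ range (p^M), ((c * j : ℕ) : ℤ)^(k-1) * ((c * j / p^M : ℕ) : ℤ)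

/-- The sum `T` restricted to `p ∤ j`. -/
def auxTs (p c k M : ℕ) : ℤ :=
  ∑ j ∈ range (p^M) with ¬ p ∣ j, ((c * j : ℕ) : ℤ)^(k-1) * ((c * j / p^M : ℕ) : ℤ)

lemma auxT_tendsto (p c k : ℕ) [hp : Fact p.Prime] (hc : Nat.Coprime p c) (hk : 1 ≤ k) :
    Tendsto (fun M : ℕ => (auxT p c k M : ℚ_[p])) atTop
      (𝓝 (((c : ℚ_[p])^k - 1) * ((bernoulli k : ℚ_[p]) / k))) := by
  have h0 : (p : ℚ_[p]) ≠ 0 := by exact_mod_cast hp.1.ne_zero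
  have hk0 : (k : ℚ_[p]) ≠ 0 := by exact_mod_cast (by omega : k ≠ 0)
  have h1 := ((aux_sum_tendsto p k).const_mul ((c : ℚ_[p])^k - 1))
  have h2 : Tendsto (fun M : ℕ => ((c : ℚ_[p])^k - 1) * (((∑ j ∈ range (p^M), (j : ℤ)^k : ℤ) : ℚ_[p]) / (p : ℚ_[p])^M) - k * (auxT p c k M : ℚ_[p])) atTop (𝓝 0) := by
    apply squeeze_zero_norm (a := fun M : ℕ => ‖(p : ℚ_[p])^M‖)
    · intro M
      obtain ⟨y, hy⟩ := aux_voronoi (p^M) c k (pow_pos hp.1.pos _) (Nat.Coprime.pow_left _ hc) hk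
      rw [← auxT] at hy
      have hy2 := congrArg (fun x : ℤ => (x : ℚ_[p])) hy
      simp only [Int.cast_sub, Int.cast_mul, Int.cast_pow, Int.cast_natCast, Int.cast_one, Nat.cast_pow] at hy2
      have : ((c : ℚ_[p])^k - 1) * (((∑ j ∈ range (p^M), (j : ℤ)^k : ℤ) : ℚ_[p]) / (p : ℚ_[p])^M) - k * (auxT p c k M : ℚ_[p]) = (p : ℚ_[p])^M * y := by
        field_simp
        linear_combination hy2
      rw [this, norm_mul]
      exact mul_le_of_le_one_right (norm_nonneg _) (Padic.norm_int_le_one _)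
    · simpa using (aux_pow_tendsto p).norm
  have h3 := (h1.sub h2).div_const (k : ℚ_[p])
  simp only [sub_sub_cancel, sub_zero] at h3
  simpa [hk0, mul_div_assoc] using h3

lemma auxTs_eq (p c k M : ℕ) [hp : Fact p.Prime] :
    auxTs p c k (M+1) = auxT p c k (M+1) - (p : ℤ)^(k-1) * auxT p c k M := by
  have hp0 := hp.1.pos
  have h1 := sum_filter_add_sum_filter_not (range (p^(M+1))) (fun j => p ∣ j)
    (fun j => ((c * j : ℕ) : ℤ)^(k-1) * ((c * j / p^(M+1) : ℕ) : ℤ))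
  have h2 : (range (p^(M+1))).filter (fun j => p ∣ j) = (range (p^M)).image (fun i => p * i) := by
    ext j
    simp only [mem_filter, mem_range, mem_image]
    constructor
    · rintro ⟨h, i, rfl⟩
      refine ⟨i, ?_, rfl⟩
      rw [pow_succ'] at h
      exact lt_of_mul_lt_mul_left h hp0.le
    · rintro ⟨i, hi, rfl⟩
      refine ⟨?_, dvd_mul_right _ _⟩
      rw [pow_succ']
      exact Nat.mul_lt_mul_of_pos_left hi hp0
  have h3 : ∑ j ∈ range (p^(M+1)) with p ∣ j, ((c * j : ℕ) : ℤ)^(k-1) * ((c * j / p^(M+1) : ℕ) : ℤ)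
      = (p : ℤ)^(k-1) * auxT p c k M := by
    rw [h2, sum_image (fun a _ b _ h => Nat.eq_of_mul_eq_mul_left hp0 h), auxT, mul_sum]
    apply sum_congr rfl
    intro i _
    have : c * (p * i) / p^(M+1) = c * i / p^M := by
      rw [pow_succ', show c * (p * i) = p * (c * i) by ring, Nat.mul_div_mul_left _ _ hp0]
    rw [this, show c * (p * i) = p * (c * i) by ring]
    push_cast
    rw [mul_pow]; ring
  rw [auxTs, auxT, ← h1, h3]; ring

lemma auxTs_tendsto (p c k : ℕ) [hp : Fact p.Prime] (hc : Nat.Coprime p c) (hk : 1 ≤ k) :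
    Tendsto (fun M : ℕ => (auxTs p c k (M+1) : ℚ_[p])) atTop
      (𝓝 (((c : ℚ_[p])^k - 1) * ((1 - (p : ℚ_[p])^(k-1)) * ((bernoulli k : ℚ_[p]) / k)))) := by
  have h := auxT_tendsto p c k hc hk
  have h1 := h.comp (tendsto_add_atTop_nat 1)
  have h2 := h1.sub (h.const_mul ((p : ℚ_[p])^(k-1)))
  have h3 : (fun M : ℕ => (auxTs p c k (M+1) : ℚ_[p])) = fun M => (auxT p c k (M+1) : ℚ_[p]) - (p : ℚ_[p])^(k-1) * (auxT p c k M : ℚ_[p]) := by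
    funext M; rw [auxTs_eq]; push_cast; rfl
  rw [h3]
  have h4 : ((c : ℚ_[p])^k - 1) * ((1 - (p : ℚ_[p])^(k-1)) * ((bernoulli k : ℚ_[p]) / k)) = ((c : ℚ_[p])^k - 1) * ((bernoulli k : ℚ_[p]) / k) - (p : ℚ_[p])^(k-1) * (((c : ℚ_[p])^k - 1) * ((bernoulli k : ℚ_[p]) / k)) := by ring
  rw [h4]
  exact h2

lemma aux_norm_le_of_tendsto (p : ℕ) [hp : Fact p.Prime] (f : ℕ → ℚ_[p]) (x : ℚ_[p]) (r : ℝ)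
    (h : Tendsto f atTop (𝓝 x)) (hf : ∀ M, ‖f M‖ ≤ r) : ‖x‖ ≤ r :=
  le_of_tendsto' h.norm hf

/-- divisibility of second differences -/
lemma aux_second (z : ℤ) (s : ℕ) : (z - 1)^2 ∣ z^s - 1 - s * (z - 1) := by
  induction s with
  | zero => simp
  | succ s ih =>
    obtain ⟨y, hy⟩ := ih
    refine ⟨z * y + s, ?_⟩
    have : z^s = 1 + s * (z-1) + (z-1)^2 * y := by linarith
    rw [pow_succ, this]; push_cast; ring

lemma aux_euler (p n x : ℕ) (hp : p.Prime) (hn : 1 ≤ n) (hx : ¬ p ∣ x) :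
    (p : ℤ)^n ∣ (x : ℤ)^((p-1) * p^(n-1)) - 1 := by
  have h := Nat.ModEq.pow_totient (n := p^n) (x := x)
    (Nat.Coprime.pow_right _ ((hp.coprime_iff_not_dvd.2 hx).symm))
  rw [Nat.totient_prime_pow hp (by omega), mul_comm] at h
  have := (Nat.modEq_iff_dvd.1 h.symm)
  simpa using this

lemma auxTs_second (p c l n s M : ℕ) (hp : p.Prime) (hn : 1 ≤ n) (hc : ¬ p ∣ c) (hl : 1 ≤ l) :
    (p : ℤ)^(n+1) ∣ auxTs p c (l + s * ((p-1) * p^(n-1))) M - auxTs p c l M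
      - s * (auxTs p c (l + (p-1) * p^(n-1)) M - auxTs p c l M) := by
  unfold auxTs
  rw [← sum_sub_distrib, ← sum_sub_distrib, mul_sum, ← sum_sub_distrib]
  apply dvd_sum
  intro j hj
  have hj' : ¬ p ∣ c * j := by
    rw [hp.dvd_mul]; push Not; exact ⟨hc, (mem_filter.1 hj).2⟩
  have h1 := aux_euler p n (c*j) hp hn hj'
  generalize (p-1) * p^(n-1) = N at *
  have e1 : l + s * N - 1 = (l - 1) + N * s := by rw [mul_comm s]; omega
  have e2 : l + N - 1 = (l - 1) + N := by omega
  rw [e1, e2, pow_add _ (l-1) (N*s), pow_add _ (l-1) N, pow_mul _ N s]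
  have h2 := aux_second (((c * j : ℕ) : ℤ)^N) s
  have h3 : (p : ℤ)^(n+1) ∣ ((((c * j : ℕ) : ℤ)^N) - 1)^2 := by
    refine dvd_trans ?_ (pow_dvd_pow_of_dvd h1 2)
    rw [← pow_mul]; exact pow_dvd_pow _ (by omega)
  have h4 := (h3.trans h2).mul_left (((c * j : ℕ) : ℤ)^(l-1) * ((c * j / p^M : ℕ) : ℤ))
  convert h4 using 1
  ring

lemma aux_exists_c (p n l : ℕ) (hp : p.Prime) (hl : ¬ (p - 1) ∣ l) :
    ∃ c : ℕ, ¬ p ∣ c ∧ (∀ k : ℕ, k ≡ l [MOD (p-1)] → ¬ (p : ℤ) ∣ (c : ℤ)^k - 1) ∧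
      (p : ℤ)^(n+1) ∣ (c : ℤ)^((p-1) * p^(n-1)) - 1 := by
  have : Fact p.Prime := ⟨hp⟩
  obtain ⟨g, hg⟩ := IsCyclic.exists_generator (α := (ZMod p)ˣ)
  have hord : orderOf g = p - 1 := by
    rw [orderOf_eq_card_of_forall_mem_zpowers hg, Nat.card_eq_fintype_card, ZMod.card_units]
  set x : ℕ := (g : ZMod p).val with hxdef
  have hx : (x : ZMod p) = g := by simp [hxdef]
  have hxp : ¬ p ∣ x := by
    rw [← ZMod.natCast_eq_zero_iff, hx]; exact g.ne_zero
  refine ⟨x^(p^n), fun h => hxp (hp.dvd_of_dvd_pow h), ?_, ?_⟩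
  · intro k hk h
    have h1 : ((((x^(p^n) : ℕ) : ℤ)^k - 1 : ℤ) : ZMod p) = 0 := (ZMod.intCast_zmod_eq_zero_iff_dvd _ _).2 h
    push_cast at h1
    rw [hx, ZMod.pow_card_pow, sub_eq_zero] at h1
    have h2 : g^k = 1 := by ext; simpa using h1
    have h3 := orderOf_dvd_of_pow_eq_one h2
    rw [hord] at h3
    exact hl ((hk.dvd_iff dvd_rfl).1 h3)
  · have h1 := aux_euler p (n+1) x hp (by omega) hxp
    simp only [Nat.add_sub_cancel] at h1
    have : (((x^(p^n) : ℕ) : ℤ)^((p-1) * p^(n-1)) - 1) = ((x : ℤ)^((p-1)*p^n))^(p^(n-1)) - 1^(p^(n-1)) := by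
      push_cast
      rw [← pow_mul, ← pow_mul, one_pow]
      congr 2; ring
    rw [this]
    exact h1.trans (sub_dvd_pow_sub_pow _ _ _)

lemma aux_sub_le (p : ℕ) [Fact p.Prime] {x y : ℚ_[p]} {r : ℝ} (hx : ‖x‖ ≤ r) (hy : ‖y‖ ≤ r) :
    ‖x - y‖ ≤ r := by
  rw [sub_eq_add_neg]
  exact (IsUltrametricDist.norm_add_le_max x (-y)).trans (max_le hx (by rwa [norm_neg]))

lemma aux_add_le (p : ℕ) [Fact p.Prime] {x y : ℚ_[p]} {r : ℝ} (hx : ‖x‖ ≤ r) (hy : ‖y‖ ≤ r) :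
    ‖x + y‖ ≤ r := (IsUltrametricDist.norm_add_le_max x y).trans (max_le hx hy)

lemma aux_mul_le (p : ℕ) [Fact p.Prime] {x y : ℚ_[p]} {r : ℝ} (hx : ‖x‖ ≤ r) (hy : ‖y‖ ≤ 1) :
    ‖x * y‖ ≤ r := by
  rw [norm_mul]
  exact (mul_le_of_le_one_right (norm_nonneg _) hy).trans hx

lemma aux_nat_le (p : ℕ) [Fact p.Prime] (s : ℕ) : ‖(s : ℚ_[p])‖ ≤ 1 := by
  simpa using Padic.norm_int_le_one (p := p) (s : ℤ)

/-- `(1 - p^(k-1)) B_k / k` -/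
noncomputable def auxG (p : ℕ) [Fact p.Prime] (k : ℕ) : ℚ_[p] :=
  (1 - (p : ℚ_[p])^(k-1)) * ((bernoulli k : ℚ_[p]) / k)

lemma aux_kummer (p n l s : ℕ) [hp : Fact p.Prime] (hn : 1 ≤ n) (hl2 : 1 ≤ l)
    (hl : ¬ (p - 1) ∣ l) :
    ‖auxG p (l + s * ((p-1) * p^(n-1))) - auxG p l
      - s * (auxG p (l + (p-1) * p^(n-1)) - auxG p l)‖ ≤ (p : ℝ)^(-((n+1 : ℕ) : ℤ)) := by
  obtain ⟨c, hc1, hc2, hc3⟩ := aux_exists_c p n l hp.1 hl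
  have hcop : Nat.Coprime p c := hp.1.coprime_iff_not_dvd.2 hc1
  have hT : ∀ k : ℕ, 1 ≤ k → Tendsto (fun M : ℕ => (auxTs p c k (M+1) : ℚ_[p])) atTop
      (𝓝 (((c : ℚ_[p])^k - 1) * auxG p k)) := fun k hk => auxTs_tendsto p c k hcop hk
  have hunit : ∀ k, k ≡ l [MOD (p-1)] → ‖(c : ℚ_[p])^k - 1‖ = 1 := by
    intro k hk
    have h1 := hc2 k hk
    rw [← Padic.norm_intCast_lt_one_iff, not_lt] at h1
    have := le_antisymm (Padic.norm_int_le_one _) h1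
    simpa using this
  have hint : ∀ k, 1 ≤ k → k ≡ l [MOD (p-1)] → ‖auxG p k‖ ≤ 1 := by
    intro k hk1 hk
    have h1 := aux_norm_le_of_tendsto p _ _ 1 (hT k hk1) (fun M => Padic.norm_int_le_one _)
    rw [norm_mul, hunit k hk, one_mul] at h1
    exact h1
  have hcs : ∀ s : ℕ, ‖(c : ℚ_[p])^(l + s * ((p-1) * p^(n-1))) - (c : ℚ_[p])^l‖ ≤ (p : ℝ)^(-((n+1 : ℕ) : ℤ)) := by
    intro s
    have h1 : (p : ℤ)^(n+1) ∣ (c : ℤ)^(l + s * ((p-1) * p^(n-1))) - (c : ℤ)^l := by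
      have h2 := (hc3.trans (sub_dvd_pow_sub_pow _ _ s)).mul_left ((c : ℤ)^l)
      have h3 : (c : ℤ)^(l + s * ((p-1) * p^(n-1))) - (c : ℤ)^l = (c : ℤ)^l * (((c : ℤ)^((p-1) * p^(n-1)))^s - 1^s) := by
        rw [pow_add, mul_comm s, pow_mul _ _ s, one_pow]; ring
      rw [h3]; exact h2
    have := (Padic.norm_int_le_pow_iff_dvd (p := p) _ (n+1)).2 h1
    simpa using this
  have hmod : ∀ s : ℕ, l + s * ((p-1) * p^(n-1)) ≡ l [MOD (p-1)] := by
    intro s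
    have : s * ((p-1) * p^(n-1)) ≡ 0 [MOD (p-1)] :=
      (Nat.modEq_zero_iff_dvd).2 (dvd_mul_of_dvd_right (dvd_mul_right _ _) _)
    simpa using (Nat.ModEq.refl l).add this
  have hE := ((hT (l + s * ((p-1) * p^(n-1))) (by omega)).sub (hT l hl2)).sub
    (((hT (l + (p-1) * p^(n-1)) (by omega)).sub (hT l hl2)).const_mul (s : ℚ_[p]))
  have hE2 := aux_norm_le_of_tendsto p _ _ ((p : ℝ)^(-((n+1 : ℕ) : ℤ))) hE (by
    intro M
    have h1 := auxTs_second p c l n s (M+1) hp.1 hn hc1 hl2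
    have := (Padic.norm_int_le_pow_iff_dvd (p := p) _ (n+1)).2 h1
    push_cast at this ⊢
    exact this)
  have h1 := hcs 1
  have m1 := hmod 1
  rw [one_mul] at h1 m1
  have ms := hmod s
  have hs := hcs s
  have hi1 := hint _ (by omega) m1
  have his := hint _ (by omega) ms
  have hu := hunit l rfl
  generalize auxG p (l + s * ((p-1) * p^(n-1))) = Gs at *
  generalize auxG p (l + (p-1) * p^(n-1)) = G1 at *
  generalize auxG p l = G0 at *
  rw [← one_mul ‖_‖, ← hu, ← norm_mul]
  have h5 := aux_add_le p (aux_sub_le p hE2 (aux_mul_le p hs his)) (aux_mul_le p (aux_mul_le p h1 hi1) (aux_nat_le p s))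
  convert h5 using 2
  ring

lemma aux_staudt (p l : ℕ) [hp : Fact p.Prime] (hle : Even l) (hl2 : 2 ≤ l) (hl : (p - 1) ∣ l) :
    1 < ‖(bernoulli l : ℚ_[p])‖ := by
  obtain ⟨k, rfl⟩ := hle
  obtain ⟨z, hz⟩ := Bernoulli.vonStaudt_clausen k
  rw [← two_mul] at *
  have hmem : p ∈ (range (2 * k + 2)).filter (fun q => q.Prime ∧ (q - 1) ∣ 2 * k) := by
    simp only [mem_filter, mem_range]
    have := Nat.le_of_dvd (by omega) hl
    exact ⟨by omega, hp.1, hl⟩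
  rw [← add_sum_erase _ _ hmem] at hz
  have hz2 := congrArg (fun x : ℚ => (x : ℚ_[p])) hz
  push_cast at hz2
  by_contra! hcon
  have hsum : ‖∑ q ∈ ((range (2 * k + 2)).filter (fun q => q.Prime ∧ (q - 1) ∣ 2 * k)).erase p, 1 / (q : ℚ_[p])‖ ≤ 1 := by
    apply IsUltrametricDist.norm_sum_le_of_forall_le_of_nonneg zero_le_one
    intro q hq
    simp only [mem_erase, mem_filter] at hq
    have : ‖(q : ℚ_[p])‖ = 1 := by
      rw [Padic.norm_natCast_eq_one_iff]
      exact (Nat.coprime_primes hp.1 hq.2.2.1).2 (Ne.symm hq.1)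
    rw [norm_div, this]; simp
  have h1 : (1 : ℚ_[p]) / p = z - bernoulli (2 * k) - ∑ q ∈ ((range (2 * k + 2)).filter (fun q => q.Prime ∧ (q - 1) ∣ 2 * k)).erase p, 1 / (q : ℚ_[p]) := by
    rw [hz2]; ring
  have h2 : ‖(1 : ℚ_[p]) / p‖ ≤ 1 := by
    rw [h1]
    exact aux_sub_le p (aux_sub_le p (Padic.norm_int_le_one _) hcon) hsum
  rw [norm_div, Padic.norm_p, norm_one, one_div, inv_inv] at h2
  have : (1 : ℝ) < p := by exact_mod_cast hp.1.one_lt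
  linarith

lemma auxG_norm (p k : ℕ) [hp : Fact p.Prime] (hk : 2 ≤ k) :
    ‖auxG p k‖ = ‖((bernoulli k / k : ℚ) : ℚ_[p])‖ := by
  have h : ‖(1 - (p : ℚ_[p])^(k-1))‖ = 1 := by
    have h1 : ¬ (p : ℤ) ∣ 1 - (p : ℤ)^(k-1) := by
      intro h
      have h2 : (p : ℤ) ∣ (p : ℤ)^(k-1) := dvd_pow_self _ (by omega)
      have h3 := dvd_add h h2
      rw [sub_add_cancel] at h3
      exact (Nat.prime_iff_prime_int.1 hp.1).not_dvd_one h3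
    rw [← Padic.norm_intCast_lt_one_iff, not_lt] at h1
    have := le_antisymm (Padic.norm_int_le_one _) h1
    simpa using this
  rw [auxG, norm_mul, h, one_mul]; push_cast; rfl

lemma auxG_sub (p n k : ℕ) [hp : Fact p.Prime] (hk : 2 ≤ k)
    (h : ‖((bernoulli k / k : ℚ) : ℚ_[p])‖ ≤ (p : ℝ)^(-(n : ℤ))) :
    ‖auxG p k - ((bernoulli k / k : ℚ) : ℚ_[p])‖ ≤ (p : ℝ)^(-((n + 1 : ℕ) : ℤ)) := by
  have hp0 : (0 : ℝ) < p := by exact_mod_cast hp.1.pos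
  have e : auxG p k - ((bernoulli k / k : ℚ) : ℚ_[p]) =
      ((p : ℚ_[p]) * ((bernoulli k / k : ℚ) : ℚ_[p])) * (-(p : ℚ_[p])^(k-2)) := by
    obtain ⟨t, rfl⟩ : ∃ t, k = t + 2 := ⟨k - 2, by omega⟩
    rw [auxG, show t + 2 - 1 = t + 1 by omega, Nat.add_sub_cancel, pow_succ]
    push_cast
    ring
  rw [e]
  apply aux_mul_le
  · rw [norm_mul, Padic.norm_p]
    calc (p : ℝ)⁻¹ * _ ≤ (p : ℝ)⁻¹ * (p : ℝ)^(-(n : ℤ)) := by gcongr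
      _ = _ := by
        rw [← zpow_neg_one, ← zpow_add₀ hp0.ne']; congr 1; push_cast; ring
  · rw [norm_neg, norm_pow]
    exact pow_le_one₀ (norm_nonneg _) Padic.norm_p_lt_one.le

lemma aux_scale (p n : ℕ) [hp : Fact p.Prime] (x : ℚ_[p]) :
    ‖x * (p : ℚ_[p])^n‖ ≤ (p : ℝ)^(-((n + 1 : ℕ) : ℤ)) ↔ ‖x‖ ≤ (p : ℝ)^(-((1 : ℕ) : ℤ)) := by
  have hp0 : (0 : ℝ) < p := by exact_mod_cast hp.1.pos
  have e : (p : ℝ)^(-((n + 1 : ℕ) : ℤ)) = (p : ℝ)^(-((1 : ℕ) : ℤ)) * (p : ℝ)^(-(n : ℤ)) := by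
    rw [← zpow_add₀ hp0.ne']; congr 1; push_cast; ring
  rw [norm_mul, Padic.norm_p_pow, e]
  exact mul_le_mul_iff_of_pos_right (by positivity)

/-- The core equivalence. -/
lemma aux_core (p n l d a₀ : ℕ) [hp : Fact p.Prime] (hn : 1 ≤ n)
    (hle : Even l) (hl2 : 2 ≤ l)
    (hord : ((p : ℤ)^n) ∣ (bernoulli l / l).num)
    (hΔ : (p : ℤ) ∣
      ((bernoulli (l + (p - 1) * p^(n - 1)) / (l + (p - 1) * p^(n - 1)) -
          bernoulli l / l) / p^n - d).num)
    (ha₀ : (p : ℤ) ∣ ((bernoulli l / l) / p^n - a₀).num) (s : ℕ) :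
    ((p : ℤ)^(n + 1)) ∣
        (bernoulli (l + s * (p - 1) * p^(n - 1)) /
          (l + s * (p - 1) * p^(n - 1))).num ↔ (p : ℤ) ∣ ((a₀ : ℤ) + s * d) := by
  have hp0 : (0 : ℝ) < p := by exact_mod_cast hp.1.pos
  have hp1 : (1 : ℝ) < p := by exact_mod_cast hp.1.one_lt
  have hpp : (p : ℚ_[p]) ≠ 0 := by exact_mod_cast hp.1.ne_zero
  have hpred : (p : ℚ) - 1 = ((p - 1 : ℕ) : ℚ) := by
    rw [Nat.cast_sub hp.1.one_le]; simp
  have c1 : (l : ℚ) + ((p : ℚ) - 1) * (p : ℚ)^(n-1) = ((l + (p-1) * p^(n-1) : ℕ) : ℚ) := by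
    rw [hpred]; push_cast; ring
  have cs : (l : ℚ) + s * ((p : ℚ) - 1) * (p : ℚ)^(n-1) = ((l + s * ((p-1) * p^(n-1)) : ℕ) : ℚ) := by
    rw [hpred]; push_cast; ring
  rw [cs, mul_assoc s (p-1)]
  rw [c1] at hΔ
  rw [aux_dvd_num_iff p _ _ hn] at hord
  rw [← pow_one (p : ℤ), aux_dvd_num_iff p _ _ le_rfl] at hΔ ha₀
  rw [aux_dvd_num_iff p _ _ (by omega), ← auxG_norm p _ (by omega)]
  have hl : ¬ (p - 1) ∣ l := by
    intro h
    have h1 := aux_staudt p l hle hl2 h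
    have h2 : ‖((bernoulli l / l : ℚ) : ℚ_[p])‖ < 1 := by
      refine hord.trans_lt ?_
      rw [zpow_neg, zpow_natCast]
      exact inv_lt_one_of_one_lt₀ (one_lt_pow₀ hp1 (by omega))
    have hl0 : (l : ℚ_[p]) ≠ 0 := by exact_mod_cast (by omega : l ≠ 0)
    have h3 : (bernoulli l : ℚ_[p]) = ((bernoulli l / l : ℚ) : ℚ_[p]) * l := by
      push_cast; field_simp
    rw [h3] at h1
    exact absurd (aux_mul_le p h2.le (aux_nat_le p l)) (not_le.2 h1)
  have hK := aux_kummer p n l s hn (by omega) hl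
  have hk1 : 2 ≤ l + (p-1) * p^(n-1) := by omega
  have hG0 := auxG_sub p n l hl2 hord
  have hG1 := auxG_sub p n _ hk1
  generalize auxG p (l + s * ((p-1) * p^(n-1))) = Gs at *
  generalize auxG p (l + (p-1) * p^(n-1)) = G1 at *
  generalize auxG p l = G0 at *
  generalize (bernoulli (l + (p-1) * p^(n-1)) / ((l + (p-1) * p^(n-1) : ℕ) : ℚ) : ℚ) = b1 at *
  generalize (bernoulli l / l : ℚ) = b0 at *
  have hΔ' : ‖(b1 : ℚ_[p]) - b0 - d * (p : ℚ_[p])^n‖ ≤ (p : ℝ)^(-((n + 1 : ℕ) : ℤ)) := by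
    have := (aux_scale p n _).2 hΔ
    push_cast at this ⊢
    convert this using 2
    field_simp
  have ha' : ‖(b0 : ℚ_[p]) - a₀ * (p : ℚ_[p])^n‖ ≤ (p : ℝ)^(-((n + 1 : ℕ) : ℤ)) := by
    have := (aux_scale p n _).2 ha₀
    push_cast at this ⊢
    convert this using 2
    field_simp
  have hmono : (p : ℝ)^(-((n + 1 : ℕ) : ℤ)) ≤ (p : ℝ)^(-(n : ℤ)) :=
    zpow_le_zpow_right₀ hp1.le (by push_cast; omega)
  have hb1 : ‖(b1 : ℚ_[p])‖ ≤ (p : ℝ)^(-(n : ℤ)) := by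
    have h1 : ‖(p : ℚ_[p])^n * d‖ ≤ (p : ℝ)^(-(n : ℤ)) :=
      aux_mul_le p (Padic.norm_p_pow n).le (aux_nat_le p d)
    have := aux_add_le p (aux_add_le p (hΔ'.trans hmono) hord) h1
    convert this using 2
    ring
  have hG1 := hG1 hb1
  have hs := aux_nat_le p s
  have hdiff : ‖Gs - ((a₀ : ℚ_[p]) + s * d) * (p : ℚ_[p])^n‖ ≤ (p : ℝ)^(-((n + 1 : ℕ) : ℤ)) := by
    have h1 := aux_add_le p (aux_add_le p hK (aux_add_le p hG0 ha'))
      (aux_mul_le p (aux_add_le p (aux_sub_le p hG1 hG0) hΔ') hs)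
    convert h1 using 2
    ring
  have e1 : (p : ℤ) ∣ ((a₀ : ℤ) + s * d) ↔ ‖((a₀ : ℚ_[p]) + s * d) * (p : ℚ_[p])^n‖ ≤ (p : ℝ)^(-((n + 1 : ℕ) : ℤ)) := by
    rw [aux_scale]
    have := (Padic.norm_int_le_pow_iff_dvd (p := p) ((a₀ : ℤ) + s * d) 1)
    rw [pow_one] at this
    rw [← this]
    push_cast
    rfl
  rw [e1]
  constructor
  · intro h
    have := aux_sub_le p h hdiff
    rwa [sub_sub_cancel] at this
  · intro h
    have := aux_add_le p hdiff h
    rwa [sub_add_cancel] at this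

/-- Let `(p, l)` be an irregular pair of order `n` with `Δ_{(p,l)} ≠ 0`.
Then there is exactly one `s` with `0 ≤ s < p` such that
`(p, l + s(p-1)p^{n-1})` is an irregular pair of order `n+1`, and it satisfies
`s ≡ -α₀ Δ_{(p,l)}⁻¹ (mod p)` (i.e. `p ∣ α₀ + s Δ`), where
`α₀ ≡ p⁻ⁿ B_l/l (mod p)`. -/
theorem stmt_15 (p n l d a₀ : ℕ) (hp : p.Prime) (hodd : Odd p) (hn : 1 ≤ n)
    (hle : Even l) (hl2 : 2 ≤ l) (hlub : l < (p - 1) * p^(n - 1))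
    (hord : ((p : ℤ)^n) ∣ (bernoulli l / l).num)
    (hd : d < p) (hdne : d ≠ 0)
    (hΔ : (p : ℤ) ∣
      ((bernoulli (l + (p - 1) * p^(n - 1)) / (l + (p - 1) * p^(n - 1)) -
          bernoulli l / l) / p^n - d).num)
    (ha₀ : (p : ℤ) ∣ ((bernoulli l / l) / p^n - a₀).num) :
    (∃! s : ℕ, s < p ∧ ((p : ℤ)^(n + 1)) ∣
        (bernoulli (l + s * (p - 1) * p^(n - 1)) /
          (l + s * (p - 1) * p^(n - 1))).num) ∧
    ∀ s : ℕ, s < p →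
      ((p : ℤ)^(n + 1)) ∣
        (bernoulli (l + s * (p - 1) * p^(n - 1)) /
          (l + s * (p - 1) * p^(n - 1))).num →
      (p : ℤ) ∣ ((a₀ : ℤ) + s * d) := by
  have : Fact p.Prime := ⟨hp⟩
  have hcore := aux_core p n l d a₀ hn hle hl2 hord hΔ ha₀
  refine ⟨?_, fun s _ h => (hcore s).1 h⟩
  have hd0 : (d : ZMod p) ≠ 0 := by
    rw [Ne, ZMod.natCast_eq_zero_iff]
    exact fun h => hdne (Nat.eq_zero_of_dvd_of_lt h hd)
  have hz : ∀ s : ℕ, (p : ℤ) ∣ ((a₀ : ℤ) + s * d) ↔ (s : ZMod p) = -a₀ / d := by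
    intro s
    rw [← ZMod.intCast_zmod_eq_zero_iff_dvd, eq_div_iff hd0]
    push_cast
    constructor
    · intro h; linear_combination h
    · intro h; linear_combination h
  refine ⟨(-a₀ / d : ZMod p).val, ⟨ZMod.val_lt _, ?_⟩, ?_⟩
  · rw [hcore, hz]; simp
  · rintro t ⟨ht, h⟩
    rw [hcore, hz] at h
    rw [← h, ZMod.val_natCast_of_lt ht]
end

section
/- Let (p, l_n) be an irregular pair of order n with \Delta_{(p,l_n)} \ne 0, and let (p, l_{n+1}) with l_{n+1} = l_n + s\varphi(p^n) be the unique related irregular pair of order n+1. Then \Delta_{(p, l_{n+1})} = \Delta_{(p, l_n)}. -/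
/-- `PV p k x`: the `p`-adic valuation of `x` is at least `k`. -/
def PV (p : ℕ) (k : ℤ) (x : ℚ) : Prop := padicNorm p x ≤ (p : ℚ) ^ (-k)

namespace PV

variable {p : ℕ} [hp : Fact p.Prime]

lemma mono {j k : ℤ} {x : ℚ} (h : PV p k x) (hjk : j ≤ k) : PV p j x := by
  unfold PV at *
  refine h.trans ?_
  have : (1 : ℚ) ≤ p := by exact_mod_cast hp.out.one_lt.le
  exact zpow_le_zpow_right₀ this (by omega)

lemma add {k : ℤ} {x y : ℚ} (hx : PV p k x) (hy : PV p k y) : PV p k (x + y) :=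
  padicNorm.nonarchimedean.trans (max_le hx hy)

lemma sub {k : ℤ} {x y : ℚ} (hx : PV p k x) (hy : PV p k y) : PV p k (x - y) :=
  padicNorm.sub.trans (max_le hx hy)

lemma neg {k : ℤ} {x : ℚ} (hx : PV p k x) : PV p k (-x) := by
  unfold PV at *; rwa [padicNorm.neg]

lemma mul {j k : ℤ} {x y : ℚ} (hx : PV p j x) (hy : PV p k y) : PV p (j + k) (x * y) := by
  unfold PV at *
  have h0 : (p : ℚ) ≠ 0 := by exact_mod_cast hp.out.ne_zero
  rw [padicNorm.mul, neg_add, zpow_add₀ h0]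
  exact mul_le_mul hx hy (padicNorm.nonneg _) (by positivity)

lemma sum {ι : Type*} {s : Finset ι} {f : ι → ℚ} {k : ℤ} (h : ∀ i ∈ s, PV p k (f i)) :
    PV p k (∑ i ∈ s, f i) :=
  padicNorm.sum_le' h (by positivity)

lemma int (z : ℤ) : PV p 0 z := by
  unfold PV; simpa using padicNorm.of_int (p := p) z

lemma nat (z : ℕ) : PV p 0 z := by
  simpa using int (p := p) z

lemma int_iff (k : ℕ) (z : ℤ) : PV p k z ↔ (p : ℤ) ^ k ∣ z := by
  unfold PV
  rw [← padicNorm.dvd_iff_norm_le]; push_cast; rfl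

lemma zpow_p (k : ℤ) : PV p k ((p : ℚ) ^ k) := by
  unfold PV
  have h0 : (p : ℚ) ≠ 0 := by exact_mod_cast hp.out.ne_zero
  rw [padicNorm.eq_zpow_of_nonzero (zpow_ne_zero _ h0)]
  rw [padicValRat.zpow, padicValRat.self hp.out.one_lt, mul_one]

lemma pow_p (k : ℕ) : PV p k ((p : ℚ) ^ k) := by
  simpa using zpow_p (p := p) k

lemma cancel {k : ℤ} {j : ℕ} {x : ℚ} (h : PV p k ((p : ℚ) ^ j * x)) : PV p (k - j) x := by
  have h0 : (p : ℚ) ≠ 0 := by exact_mod_cast hp.out.ne_zero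
  have := (zpow_p (p := p) (-(j : ℤ))).mul h
  have e : (p : ℚ) ^ (-(j : ℤ)) * ((p : ℚ) ^ j * x) = x := by
    rw [zpow_neg, zpow_natCast]; field_simp
  rw [e] at this
  exact this.mono (by omega)

lemma exists_bound (x : ℚ) : ∃ C : ℕ, PV p (-(C : ℤ)) x := by
  by_cases hx : x = 0
  · refine ⟨0, ?_⟩; subst hx; simp [PV]
  obtain ⟨z, hz⟩ := padicNorm.values_discrete (p := p) hx
  refine ⟨z.natAbs, mono (k := z) ?_ (by omega)⟩
  unfold PV; exact hz.le

lemma of_num {k : ℕ} (hk : 1 ≤ k) {x : ℚ} (h : (p : ℤ) ^ k ∣ x.num) : PV p k x := by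
  have h1 : PV p k (x.num : ℚ) := (int_iff k _).2 h
  have hpd : ¬ p ∣ x.den := by
    intro hd
    have h2 : p ∣ x.num.natAbs := by
      rw [← Int.natCast_dvd]
      exact (dvd_pow_self _ (by omega)).trans h
    exact hp.out.one_lt.ne' (Nat.eq_one_of_dvd_coprimes x.reduced h2 hd)
  unfold PV at *
  have e : x = x.num / x.den := (Rat.num_div_den x).symm
  rw [e, padicNorm.div, (padicNorm.nat_eq_one_iff (p := p) x.den).2 hpd, div_one]
  exact h1

end PV

/-- irregular implies `p - 1 ∤ l` -/
lemma not_dvd_of_irr {p : ℕ} [hp : Fact p.Prime] {l : ℕ} (hle : Even l) (hl2 : 2 ≤ l)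
    (h : PV p 1 (bernoulli l / l)) : ¬ (p - 1) ∣ l := by
  intro hd
  have hl0 : (l : ℚ) ≠ 0 := by exact_mod_cast (by omega : l ≠ 0)
  have hB : PV p 0 (bernoulli l) := by
    have := (PV.nat (p := p) l).mul h
    rw [mul_div_cancel₀ _ hl0] at this
    exact this.mono (by norm_num)
  obtain ⟨k, hk⟩ := hle
  have hk2 : l = 2 * k := by omega
  obtain ⟨z, hz⟩ := Bernoulli.vonStaudt_clausen k
  rw [← hk2] at hz
  have hmem : p ∈ (Finset.range (l + 2)).filter (fun q => q.Prime ∧ (q - 1) ∣ l) := by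
    simp only [Finset.mem_filter, Finset.mem_range]
    have := Nat.le_of_dvd (by omega) hd
    exact ⟨by omega, hp.out, hd⟩
  rw [← Finset.add_sum_erase _ _ hmem] at hz
  have hrest : PV p 0 (∑ q ∈ ((Finset.range (l + 2)).filter
      (fun q => q.Prime ∧ (q - 1) ∣ l)).erase p, (1 : ℚ) / q) := by
    refine PV.sum fun q hq => ?_
    simp only [Finset.mem_erase, Finset.mem_filter] at hq
    have : Fact q.Prime := ⟨hq.2.2.1⟩
    unfold PV
    rw [padicNorm.div, padicNorm.padicNorm_of_prime_of_ne (fun e => hq.1 e.symm)]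
    simp
  have hp1 : PV p 0 ((1 : ℚ) / p) := by
    have := ((PV.int (p := p) z).sub hB).sub hrest
    rw [hz] at this
    convert this using 1
    ring
  have h2 : PV p (1 + 0) ((p : ℚ) * (1 / p)) := by
    have := (PV.pow_p (p := p) 1).mul hp1
    simpa using this
  have h0 : (p : ℚ) ≠ 0 := by exact_mod_cast hp.out.ne_zero
  rw [mul_one_div_cancel h0] at h2
  have := (PV.int_iff (p := p) 1 1).1 (by simpa using h2)
  have h3 : (p : ℤ) ∣ 1 := by simpa using this
  have := Int.natCast_dvd_natCast.1 (by simpa using h3 : (p : ℤ) ∣ (1 : ℕ))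
  exact hp.out.one_lt.ne' (Nat.dvd_one.1 this)

lemma exists_root {p : ℕ} [hp : Fact p.Prime] {l : ℕ} (h : ¬ (p - 1) ∣ l) :
    ∃ a : ℕ, a.Coprime p ∧ ¬ (p : ℤ) ∣ (a : ℤ) ^ l - 1 := by
  have := (FiniteField.forall_pow_eq_one_iff (ZMod p) l).not
  rw [ZMod.card] at this
  have h1 := this.2 h
  push Not at h1
  obtain ⟨x, hx⟩ := h1
  refine ⟨(x : ZMod p).val, ZMod.val_coe_unit_coprime x, ?_⟩
  intro hd
  apply hx
  have h2 := (ZMod.intCast_zmod_eq_zero_iff_dvd _ p).2 hd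
  push_cast at h2
  rw [ZMod.natCast_zmod_val, sub_eq_zero] at h2
  ext
  push_cast
  exact h2

/-- Voronoi sums -/
def WW (a q m : ℕ) : ℕ := ∑ x ∈ Finset.range q, (a * x / q) * (a * x) ^ (m - 1)

lemma sum_perm {a q : ℕ} (hq : 0 < q) (h : a.Coprime q) (m : ℕ) :
    ∑ x ∈ Finset.range q, (a * x % q) ^ m = ∑ x ∈ Finset.range q, x ^ m := by
  have hinj : Set.InjOn (fun x => a * x % q) (Finset.range q : Set ℕ) := by
    intro x hx y hy hxy
    simp only [Finset.coe_range, Set.mem_Iio] at hx hy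
    have h1 : a * x ≡ a * y [MOD q] := hxy
    have h2 := Nat.ModEq.cancel_left_of_coprime (Nat.Coprime.symm h) h1
    exact h2.eq_of_lt_of_lt hx hy
  have himg : (Finset.range q).image (fun x => a * x % q) = Finset.range q := by
    apply Finset.eq_of_subset_of_card_le
    · intro y hy
      simp only [Finset.mem_image, Finset.mem_range] at hy ⊢
      obtain ⟨x, _, rfl⟩ := hy
      exact Nat.mod_lt _ hq
    · rw [Finset.card_image_of_injOn hinj]
  conv_rhs => rw [← himg, Finset.sum_image hinj]

lemma voronoi_int {a q m : ℕ} (hq : 0 < q) (h : a.Coprime q) : ∃ z : ℤ,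
    ((a : ℤ) ^ m - 1) * ∑ x ∈ Finset.range q, (x : ℤ) ^ m = m * q * (WW a q m : ℤ) + q ^ 2 * z := by
  have key : ∀ x : ℕ, ∃ k : ℤ, ((a * x % q : ℕ) : ℤ) ^ m
      = (a * x : ℤ) ^ m - m * q * ((a * x / q : ℕ) * (a * x : ℤ) ^ (m - 1)) + q ^ 2 * k := by
    intro x
    obtain ⟨k, hk⟩ := Polynomial.powAddExpansion (a * x : ℤ) (-(q * (a * x / q : ℕ) : ℤ)) m
    refine ⟨k * ((a * x / q : ℕ) : ℤ) ^ 2, ?_⟩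
    have e : ((a * x % q : ℕ) : ℤ) = a * x + -(q * (a * x / q : ℕ) : ℤ) := by
      have := Nat.mod_add_div (a * x) q
      have h2 : ((a * x % q : ℕ) : ℤ) + q * (a * x / q : ℕ) = a * x := by exact_mod_cast this
      linarith
    rw [e, hk]; ring
  choose k hk using key
  have hs : (∑ x ∈ Finset.range q, ((a * x % q : ℕ) : ℤ) ^ m) = ∑ x ∈ Finset.range q, (x : ℤ) ^ m := by
    exact_mod_cast sum_perm hq h m
  refine ⟨-∑ x ∈ Finset.range q, k x, ?_⟩
  simp_rw [hk] at hs
  rw [Finset.sum_add_distrib, Finset.sum_sub_distrib, ← Finset.mul_sum, ← Finset.mul_sum] at hs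
  simp_rw [mul_pow (a : ℤ) _ m] at hs
  rw [← Finset.mul_sum] at hs
  have hW : (WW a q m : ℤ) = ∑ x ∈ Finset.range q, ((a * x / q : ℕ) : ℤ) * (a * x : ℤ) ^ (m - 1) := by
    unfold WW; push_cast; rfl
  rw [hW]
  linear_combination hs

lemma faulhaber_bound {p : ℕ} [hp : Fact p.Prime] (m : ℕ) : ∃ C : ℕ, ∀ q : ℕ, ∃ T : ℚ,
    PV p (-(C : ℤ)) T ∧ ∑ x ∈ Finset.range q, (x : ℚ) ^ m = q * bernoulli m + q ^ 2 * T := by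
  have hb := fun i : ℕ => PV.exists_bound (p := p) (bernoulli i * ((m + 1).choose i) / (m + 1))
  choose c hc using hb
  refine ⟨∑ i ∈ Finset.range m, c i, fun q => ⟨∑ i ∈ Finset.range m,
    (bernoulli i * ((m + 1).choose i) / (m + 1)) * ((q ^ (m - 1 - i) : ℕ) : ℚ), ?_, ?_⟩⟩
  · refine PV.sum fun i hi => ?_
    refine ((hc i).mul (PV.nat _)).mono ?_
    have := Finset.single_le_sum (f := c) (fun _ _ => Nat.zero_le _) hi
    rw [add_zero]
    have : ((c i : ℕ) : ℤ) ≤ ((∑ i ∈ Finset.range m, c i : ℕ) : ℤ) := by exact_mod_cast this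
    omega
  · rw [sum_range_pow, Finset.sum_range_succ, Finset.mul_sum, add_comm]
    congr 1
    · have : (m : ℚ) + 1 ≠ 0 := by positivity
      simp
      field_simp
    · refine Finset.sum_congr rfl fun i hi => ?_
      have hi' := Finset.mem_range.1 hi
      have : m + 1 - i = 2 + (m - 1 - i) := by omega
      rw [this, pow_add]; push_cast; ring

lemma voronoi_limit {p : ℕ} [hp : Fact p.Prime] {a m : ℕ} (hm : m ≠ 0) (h : a.Coprime p) (M : ℕ) :
    ∃ N0 : ℕ, ∀ N ≥ N0, PV p M (((a : ℚ) ^ m - 1) * (bernoulli m / m) - WW a (p ^ N) m) := by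
  obtain ⟨C, hC⟩ := faulhaber_bound (p := p) m
  obtain ⟨D, hD⟩ := PV.exists_bound (p := p) (1 / (m : ℚ))
  refine ⟨M + C + D, fun N hN => ?_⟩
  obtain ⟨T, hT, hS⟩ := hC (p ^ N)
  obtain ⟨z, hz⟩ := voronoi_int (m := m) (pow_pos hp.out.pos N) (Nat.Coprime.pow_right N h)
  have hzQ : ((a : ℚ) ^ m - 1) * ∑ x ∈ Finset.range (p ^ N), (x : ℚ) ^ m
      = m * (p ^ N : ℕ) * (WW a (p ^ N) m : ℚ) + (p ^ N : ℕ) ^ 2 * z := by exact_mod_cast hz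
  rw [hS] at hzQ
  have hm0 : (m : ℚ) ≠ 0 := by exact_mod_cast hm
  have h0 : ((p ^ N : ℕ) : ℚ) ≠ 0 := by exact_mod_cast (pow_pos hp.out.pos N).ne'
  have e : ((a : ℚ) ^ m - 1) * (bernoulli m / m) - WW a (p ^ N) m
      = (p : ℚ) ^ N * ((1 / m) * (z - ((a ^ m : ℕ) - (1 : ℤ) : ℚ) * T)) := by
    have : (p : ℚ) ^ N = ((p ^ N : ℕ) : ℚ) := by push_cast; rfl
    rw [this]
    field_simp
    push_cast at hzQ h0 ⊢
    apply mul_left_cancel₀ h0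
    linear_combination hzQ
  rw [e]
  have h1 : PV p (-(C : ℤ)) (z - ((a ^ m : ℕ) - (1 : ℤ) : ℚ) * T) := by
    refine ((PV.int z).mono (by omega)).sub ?_
    exact (((PV.nat _).sub (PV.int _)).mul hT).mono (by omega)
  exact ((PV.pow_p N).mul (hD.mul h1)).mono (by omega)

/-- Voronoi sums over units -/
def UU (p a N m : ℕ) : ℕ :=
  ∑ x ∈ (Finset.range (p ^ N)).filter (fun x => ¬ p ∣ x), (a * x / p ^ N) * (a * x) ^ (m - 1)

lemma WW_split {p : ℕ} [hp : Fact p.Prime] (a N m : ℕ) :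
    WW a (p ^ (N + 1)) m = UU p a (N + 1) m + p ^ (m - 1) * WW a (p ^ N) m := by
  unfold WW UU
  rw [← Finset.sum_filter_not_add_sum_filter (Finset.range (p ^ (N + 1))) (fun x => p ∣ x)]
  congr 1
  have himg : (Finset.range (p ^ (N + 1))).filter (fun x => p ∣ x)
      = (Finset.range (p ^ N)).image (fun y => p * y) := by
    ext x
    simp only [Finset.mem_filter, Finset.mem_range, Finset.mem_image]
    constructor
    · rintro ⟨hx, y, rfl⟩
      refine ⟨y, ?_, rfl⟩
      rw [pow_succ, mul_comm] at hx
      exact Nat.lt_of_mul_lt_mul_right hx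
    · rintro ⟨y, hy, rfl⟩
      refine ⟨?_, dvd_mul_right _ _⟩
      rw [pow_succ, mul_comm]
      exact Nat.mul_lt_mul_of_pos_right hy hp.out.pos
  rw [himg, Finset.sum_image (fun x _ y _ hxy => Nat.eq_of_mul_eq_mul_left hp.out.pos hxy),
    Finset.mul_sum]
  refine Finset.sum_congr rfl fun y _ => ?_
  have e1 : a * (p * y) = p * (a * y) := by ring
  have e2 : p ^ (N + 1) = p * p ^ N := by ring
  rw [e1, e2, Nat.mul_div_mul_left _ _ hp.out.pos, mul_pow]
  ring

lemma cubic (x : ℤ) (m : ℕ) : ∃ k : ℤ, (1 + x) ^ m = 1 + m * x + (m.choose 2 : ℤ) * x ^ 2 + k * x ^ 3 := by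
  induction m with
  | zero => exact ⟨0, by simp⟩
  | succ m ih =>
    obtain ⟨k, hk⟩ := ih
    refine ⟨k + (m.choose 2 : ℤ) + k * x, ?_⟩
    rw [pow_succ, hk, Nat.choose_succ_succ' m 1]
    push_cast [Nat.choose_one_right]
    ring

lemma pow_diff {p : ℕ} [hp : Fact p.Prime] (hodd : Odd p) {n : ℕ} (hn : 1 ≤ n) (s : ℕ) (t : ℤ) :
    ∃ z : ℤ, (1 + (p : ℤ) ^ n * t) ^ (s + p) - (1 + (p : ℤ) ^ n * t) ^ s
      = (p : ℤ) ^ (n + 1) * t + (p : ℤ) ^ (n + 2) * z := by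
  obtain ⟨r, rfl⟩ : ∃ r, n = r + 1 := ⟨n - 1, by omega⟩
  obtain ⟨k, hk⟩ := cubic ((p : ℤ) ^ (r + 1) * t) p
  obtain ⟨c, hc⟩ : p ∣ p.choose 2 := hp.out.dvd_choose_self (by norm_num) (by
    rcases hodd with ⟨u, hu⟩; have := hp.out.two_le; omega)
  obtain ⟨w, hw⟩ : ∃ w : ℤ, (1 + (p : ℤ) ^ (r + 1) * t) ^ s = 1 + p * w := by
    obtain ⟨w, hw⟩ := sub_dvd_pow_sub_pow (1 + (p : ℤ) ^ (r + 1) * t) 1 s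
    refine ⟨(p : ℤ) ^ r * t * w, ?_⟩
    rw [one_pow] at hw
    linear_combination hw
  rw [pow_add, hk, hc, hw]
  push_cast
  refine ⟨t * w + (1 + p * w) * ((p : ℤ) ^ r * c * t ^ 2 + k * (p : ℤ) ^ (2 * r) * t ^ 3), ?_⟩
  ring

lemma UU_diff {p : ℕ} [hp : Fact p.Prime] (hodd : Odd p) {n : ℕ} (hn : 1 ≤ n) {a : ℕ}
    (ha : a.Coprime p) (N s : ℕ) {l : ℕ} (hl : 2 ≤ l) : ∃ I z : ℤ,
    (UU p a N (l + (p - 1) * p ^ (n - 1)) : ℤ) - UU p a N l = (p : ℤ) ^ n * I ∧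
    (UU p a N (l + (s + p) * ((p - 1) * p ^ (n - 1))) : ℤ)
      - UU p a N (l + s * ((p - 1) * p ^ (n - 1))) = (p : ℤ) ^ (n + 1) * I + (p : ℤ) ^ (n + 2) * z := by
  have ht : ∀ x : ℕ, ∃ t : ℤ, ¬ p ∣ x →
      ((a * x : ℕ) : ℤ) ^ ((p - 1) * p ^ (n - 1)) = 1 + (p : ℤ) ^ n * t := by
    intro x
    by_cases hx : p ∣ x
    · exact ⟨0, fun h => absurd hx h⟩
    have hc : (a * x).Coprime (p ^ n) := by
      apply Nat.Coprime.pow_right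
      exact Nat.Coprime.mul_left ha ((hp.out.coprime_iff_not_dvd.2 hx).symm)
    have := Nat.ModEq.pow_totient hc
    rw [Nat.totient_prime_pow hp.out (by omega), mul_comm] at this
    have h2 := (Nat.modEq_iff_dvd.1 this.symm)
    obtain ⟨t, ht⟩ := h2
    refine ⟨t, fun _ => ?_⟩
    push_cast at ht ⊢
    linear_combination ht
  choose t ht using ht
  choose z hz using fun x => pow_diff hodd hn s (t x)
  refine ⟨∑ x ∈ (Finset.range (p ^ N)).filter (fun x => ¬ p ∣ x),
      ((a * x / p ^ N : ℕ) : ℤ) * ((a * x : ℕ) : ℤ) ^ (l - 1) * t x,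
    ∑ x ∈ (Finset.range (p ^ N)).filter (fun x => ¬ p ∣ x),
      ((a * x / p ^ N : ℕ) : ℤ) * ((a * x : ℕ) : ℤ) ^ (l - 1) * z x, ?_, ?_⟩
  · unfold UU
    rw [Nat.cast_sum, Nat.cast_sum, ← Finset.sum_sub_distrib, Finset.mul_sum]
    refine Finset.sum_congr rfl fun x hx => ?_
    have hx' := ht x (Finset.mem_filter.1 hx).2
    rw [show l + (p - 1) * p ^ (n - 1) - 1 = (l - 1) + (p - 1) * p ^ (n - 1) by omega, pow_add]
    rw [Nat.cast_mul, Nat.cast_mul, Nat.cast_mul, Nat.cast_pow, Nat.cast_pow, hx']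
    ring
  · unfold UU
    rw [Nat.cast_sum, Nat.cast_sum, ← Finset.sum_sub_distrib, Finset.mul_sum, Finset.mul_sum,
      ← Finset.sum_add_distrib]
    refine Finset.sum_congr rfl fun x hx => ?_
    have hx' := ht x (Finset.mem_filter.1 hx).2
    have hzx := hz x
    rw [← hx', ← pow_mul, ← pow_mul] at hzx
    generalize (p - 1) * p ^ (n - 1) = f at *
    rw [show l + (s + p) * f - 1 = (l - 1) + f * (s + p) by rw [mul_comm f]; omega,
      show l + s * f - 1 = (l - 1) + f * s by rw [mul_comm f]; omega, pow_add, pow_add]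
    rw [Nat.cast_mul, Nat.cast_mul, Nat.cast_mul, Nat.cast_mul, Nat.cast_pow, Nat.cast_pow,
      Nat.cast_pow]
    linear_combination ((a * x / p ^ N : ℕ) : ℤ) * ((a * x : ℕ) : ℤ) ^ (l - 1) * hzx

lemma UU_approx {p : ℕ} [hp : Fact p.Prime] {a : ℕ} (ha : a.Coprime p) (M : ℕ) {m : ℕ}
    (hm : 2 ≤ m) : ∃ N0, ∀ N ≥ N0, ∀ j : ℕ, j + 1 ≤ M → PV p j (bernoulli m / m) →
    PV p (j + 1) ((UU p a N m : ℚ) - ((a : ℚ) ^ m - 1) * (bernoulli m / m)) := by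
  obtain ⟨N0, h⟩ := voronoi_limit (by omega : m ≠ 0) ha M
  refine ⟨N0 + 1, fun N hN j hj hB => ?_⟩
  obtain ⟨K, rfl⟩ : ∃ K, N = K + 1 := ⟨N - 1, by omega⟩
  have h1 := h (K + 1) (by omega)
  have h2 := h K (by omega)
  have hs : (WW a (p ^ (K + 1)) m : ℚ) = UU p a (K + 1) m + (p : ℚ) ^ (m - 1) * WW a (p ^ K) m := by
    exact_mod_cast WW_split a K m
  have hpw : PV p 1 ((p : ℚ) ^ (m - 1)) := (PV.pow_p (m - 1)).mono (by omega)
  have hG : PV p j (((a : ℚ) ^ m - 1) * (bernoulli m / m)) := by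
    have : PV p 0 (((a ^ m : ℕ) : ℚ) - ((1 : ℕ) : ℚ)) := (PV.nat _).sub (PV.nat _)
    have := this.mul hB
    push_cast at this
    exact this.mono (by omega)
  have e : (UU p a (K + 1) m : ℚ) - ((a : ℚ) ^ m - 1) * (bernoulli m / m)
      = -(((a : ℚ) ^ m - 1) * (bernoulli m / m) - WW a (p ^ (K + 1)) m)
        + ((p : ℚ) ^ (m - 1) * (((a : ℚ) ^ m - 1) * (bernoulli m / m) - WW a (p ^ K) m)
        - (p : ℚ) ^ (m - 1) * (((a : ℚ) ^ m - 1) * (bernoulli m / m))) := by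
    rw [hs]; ring
  rw [e]
  exact (h1.neg.mono (by omega)).add (((hpw.mul h2).mono (by omega)).sub
    ((hpw.mul hG).mono (by omega)))

/-- combination step -/
lemma combine {p : ℕ} [hp : Fact p.Prime] {n : ℕ} (hn : 1 ≤ n) {f0 f1 h0 h1 u0 u1 d I : ℚ}
    (hf0 : PV p n f0) (hΔ : PV p 1 ((f1 - f0) / (p : ℚ) ^ n - d))
    (hd : PV p 0 d) (hh0 : PV p 0 h0) (hh : PV p 1 (h1 - h0))
    (hu0 : PV p (n + 1) (u0 - h0 * f0)) (hu1 : PV p (n + 1) (u1 - h1 * f1))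
    (hI : PV p (n + 1) (u1 - u0 - (p : ℚ) ^ n * I)) : PV p 1 (h0 * d - I) := by
  have h0' : (p : ℚ) ≠ 0 := by exact_mod_cast hp.out.ne_zero
  have hfd : PV p (n + 1) (f1 - f0 - (p : ℚ) ^ n * d) := by
    have := (PV.pow_p (p := p) n).mul hΔ
    convert this using 1
    field_simp
  have h1' : PV p 0 h1 := by
    have := hh0.add (hh.mono (by omega : (0 : ℤ) ≤ 1))
    convert this using 1; ring
  have key : PV p (n + 1) ((p : ℚ) ^ n * (h0 * d - I)) := by
    have a1 := (h1'.mul hfd).mono (by omega : ((n : ℤ) + 1) ≤ 0 + (n + 1))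
    have a2 := (hh.mul hf0).mono (by omega : ((n : ℤ) + 1) ≤ 1 + n)
    have a3 := ((hh.mul (PV.pow_p n)).mul hd).mono (by omega : ((n : ℤ) + 1) ≤ 1 + n + 0)
    have := (((((hI.sub hu1).add hu0).sub a1).sub a2).sub a3)
    convert this using 1
    ring
  exact key.cancel.mono (by omega)

/-- transfer of integrality along the difference quotient -/
lemma transfer {p : ℕ} [hp : Fact p.Prime] {n : ℕ} {f0 f1 d : ℚ}
    (hf0 : PV p n f0) (hΔ : PV p 1 ((f1 - f0) / (p : ℚ) ^ n - d)) (hd : PV p 0 d) : PV p n f1 := by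
  have h0' : (p : ℚ) ≠ 0 := by exact_mod_cast hp.out.ne_zero
  have := (PV.pow_p (p := p) n).mul ((hΔ.mono (by omega : (0 : ℤ) ≤ 1)).add hd)
  have := (this.mono (by omega : (n : ℤ) ≤ n + 0)).add hf0
  convert this using 1
  field_simp
  ring

lemma hh_diff {p : ℕ} [hp : Fact p.Prime] {a : ℕ} (ha : a.Coprime p) (m k : ℕ) :
    PV p 1 (((a : ℚ) ^ (m + (p - 1) * k) - 1) - ((a : ℚ) ^ m - 1)) := by
  have h := Nat.ModEq.pow_totient ha
  rw [Nat.totient_prime hp.out] at h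
  have h2 := (h.pow k).mul_left (a ^ m)
  rw [one_pow, mul_one, ← pow_mul, ← pow_add] at h2
  have h3 := Nat.modEq_iff_dvd.1 h2.symm
  have h4 := (PV.int_iff (p := p) 1 _).2 (by simpa using h3)
  push_cast at h4
  convert h4 using 1
  ring

/-- Let `(p, l)` be an irregular pair of order `n` with `Δ_{(p,l)} ≠ 0`, and let
`(p, l')`, `l' = l + s φ(pⁿ)`, be the related irregular pair of order `n+1`.
Then `Δ_{(p,l')} = Δ_{(p,l)}`, where both `Δ`'s are the least nonnegative
residues mod `p` of `p⁻ᵐ(B_{λ+φ(pᵐ)}/(λ+φ(pᵐ)) - B_λ/λ)` for the respective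
orders `m` and indices `λ`. -/
theorem stmt_16 (p n l s d d' : ℕ) (hp : p.Prime) (hodd : Odd p) (hn : 1 ≤ n)
    (hle : Even l) (hl2 : 2 ≤ l) (hlub : l < (p - 1) * p^(n - 1))
    (hord : ((p : ℤ)^n) ∣ (bernoulli l / l).num)
    (hd : d < p) (hdne : d ≠ 0)
    (hΔ : (p : ℤ) ∣
      ((bernoulli (l + (p - 1) * p^(n - 1)) / (l + (p - 1) * p^(n - 1)) -
          bernoulli l / l) / p^n - d).num)
    (hs : s < p)
    (hord' : ((p : ℤ)^(n + 1)) ∣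
      (bernoulli (l + s * (p - 1) * p^(n - 1)) /
        (l + s * (p - 1) * p^(n - 1))).num)
    (hd' : d' < p)
    (hΔ' : (p : ℤ) ∣
      ((bernoulli (l + s * (p - 1) * p^(n - 1) + (p - 1) * p^n) /
          (l + s * (p - 1) * p^(n - 1) + (p - 1) * p^n) -
        bernoulli (l + s * (p - 1) * p^(n - 1)) /
          (l + s * (p - 1) * p^(n - 1))) / p^(n + 1) - d').num) :
    d' = d := by
  have hpF : Fact p.Prime := ⟨hp⟩
  have hp2 := hp.two_le
  have c1 : ((p - 1 : ℕ) : ℚ) = (p : ℚ) - 1 := by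
    rw [Nat.cast_sub (by omega)]; simp
  -- the four indices
  set m1 := l + (p - 1) * p ^ (n - 1) with hm1
  set m2 := l + s * (p - 1) * p ^ (n - 1) with hm2
  set m3 := m2 + (p - 1) * p ^ n with hm3
  have e1 : (l : ℚ) + ((p : ℚ) - 1) * (p : ℚ) ^ (n - 1) = (m1 : ℚ) := by
    rw [hm1]; push_cast [c1]; rfl
  have e2 : (l : ℚ) + s * ((p : ℚ) - 1) * (p : ℚ) ^ (n - 1) = (m2 : ℚ) := by
    rw [hm2]; push_cast [c1]; rfl
  have e3 : (m2 : ℚ) + ((p : ℚ) - 1) * (p : ℚ) ^ n = (m3 : ℚ) := by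
    rw [hm3]; push_cast [c1]; rfl
  rw [e2, e3] at hΔ'
  rw [e1] at hΔ
  rw [e2] at hord'
  have hf0 : PV p n (bernoulli l / l) := PV.of_num hn hord
  have hf2 : PV p ((n + 1 : ℕ) : ℤ) (bernoulli m2 / m2) := PV.of_num (by omega) hord'
  have hD : PV p 1 ((bernoulli m1 / m1 - bernoulli l / l) / (p : ℚ) ^ n - d) := by
    simpa using PV.of_num (p := p) (k := 1) le_rfl (by simpa using hΔ)
  have hD' : PV p 1 ((bernoulli m3 / m3 - bernoulli m2 / m2) / (p : ℚ) ^ (n + 1) - d') := by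
    simpa using PV.of_num (p := p) (k := 1) le_rfl (by simpa using hΔ')
  have hf1 := transfer hf0 hD (PV.nat d)
  have hf3 := transfer hf2 hD' (PV.nat d')
  obtain ⟨a, ha, hal⟩ := exists_root (not_dvd_of_irr hle hl2 (hf0.mono (by omega)))
  have hm1' : 2 ≤ m1 := by omega
  have hm2' : 2 ≤ m2 := by omega
  have hm3' : 2 ≤ m3 := by omega
  obtain ⟨N0, hN0⟩ := UU_approx ha (n + 2) hl2
  obtain ⟨N1, hN1⟩ := UU_approx ha (n + 2) hm1'
  obtain ⟨N2, hN2⟩ := UU_approx ha (n + 2) hm2'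
  obtain ⟨N3, hN3⟩ := UU_approx ha (n + 2) hm3'
  have hu0 := hN0 (N0 + N1 + N2 + N3) (by omega) n (by omega) hf0
  have hu1 := hN1 (N0 + N1 + N2 + N3) (by omega) n (by omega) hf1
  have hu2 := hN2 (N0 + N1 + N2 + N3) (by omega) (n + 1) (by omega) hf2
  have hu3 := hN3 (N0 + N1 + N2 + N3) (by omega) (n + 1) (by omega) hf3
  generalize N0 + N1 + N2 + N3 = N at hu0 hu1 hu2 hu3
  obtain ⟨I, z, hI, hz⟩ := UU_diff hodd hn ha N s hl2
  have i2 : l + s * ((p - 1) * p ^ (n - 1)) = m2 := by rw [hm2]; ring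
  have i3 : l + (s + p) * ((p - 1) * p ^ (n - 1)) = m3 := by
    rw [hm3, hm2]
    obtain ⟨r, rfl⟩ : ∃ r, n = r + 1 := ⟨n - 1, by omega⟩
    rw [Nat.add_sub_cancel, pow_succ]; ring
  rw [i2, i3] at hz
  rw [← hm1] at hI
  have hIQ : (UU p a N m1 : ℚ) - UU p a N l = (p : ℚ) ^ n * I := by exact_mod_cast hI
  have hzQ : (UU p a N m3 : ℚ) - UU p a N m2 = (p : ℚ) ^ (n + 1) * I + (p : ℚ) ^ (n + 2) * z := by
    exact_mod_cast hz
  have hint : ∀ m : ℕ, PV p 0 ((a : ℚ) ^ m - 1) := by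
    intro m
    have := (PV.nat (p := p) (a ^ m)).sub (PV.nat 1)
    push_cast at this
    exact this
  have r1 : PV p 1 (((a : ℚ) ^ l - 1) * d - I) := by
    refine combine hn hf0 hD (PV.nat d) (hint l) (hh_diff ha l (p ^ (n - 1))) hu0 hu1 ?_
    rw [hIQ, sub_self]
    exact (PV.int_iff (n + 1) 0).2 (dvd_zero _)
  have r2 : PV p 1 (((a : ℚ) ^ m2 - 1) * d' - I) := by
    refine combine (by omega : 1 ≤ n + 1) hf2 hD' (PV.nat d') (hint m2) (hh_diff ha m2 (p ^ n))
      hu2 hu3 ?_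
    rw [hzQ, add_sub_cancel_left]
    exact ((PV.pow_p (n + 2)).mul (PV.int z)).mono (by push_cast; omega)
  have r3 : PV p 1 (((a : ℚ) ^ m2 - 1) - ((a : ℚ) ^ l - 1)) := by
    have := hh_diff ha l (s * p ^ (n - 1))
    rwa [show l + (p - 1) * (s * p ^ (n - 1)) = m2 by rw [hm2]; ring] at this
  have r4 : PV p 1 (((a : ℚ) ^ l - 1) * ((d' : ℚ) - d)) := by
    have := (r2.sub r1).sub ((r3.mul (PV.nat d')).mono (by omega : (1 : ℤ) ≤ 1 + 0))
    convert this using 1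
    ring
  have r5 : (p : ℤ) ∣ ((a : ℤ) ^ l - 1) * ((d' : ℤ) - d) := by
    have := (PV.int_iff (p := p) 1 (((a : ℤ) ^ l - 1) * ((d' : ℤ) - d))).1 (by
      push_cast; exact r4)
    simpa using this
  have r6 := ((Nat.prime_iff_prime_int.1 hp).dvd_or_dvd r5).resolve_left hal
  have r7 := Int.eq_zero_of_abs_lt_dvd r6 (by rw [abs_lt]; constructor <;> omega)
  omega
end
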